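/- arXiv:math/9207217 — 3 statements merged into one kernel-verified Lean document; each statement's English description precedes it below -/
import Mathlib

section
/- Let p be a prime and let G₁, G₂ be finite groups. Then the following are equivalent: (i) for every finite p-group Q, the permutation F_p[Out(Q)]-modules F_p Rep(Q,G₁) and F_p Rep(Q,G₂) are isomorphic; (ii) for every finite p-group Q, the permutation F_p[Out(Q)]-modules F_p Inj(Q,G₁) and F_p Inj(Q,G₂) are isomorphic. -/
/-- The subgroup of inner automorphisms of `Q`. -/
def Inn (Q : Type) [Group Q] : Subgroup (MulAut Q) := (MulAut.conj (G := Q)).range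

instance Inn.normal (Q : Type) [Group Q] : (Inn Q).Normal := by
  constructor
  rintro - ⟨q, rfl⟩ g
  refine ⟨g q, ?_⟩
  ext x
  simp [MulAut.conj_apply, map_mul, map_inv]

/-- The outer automorphism group `Out Q = Aut(Q)/Inn(Q)`. -/
def Out (Q : Type) [Group Q] : Type := MulAut Q ⧸ Inn Q

instance (Q : Type) [Group Q] : Group (Out Q) := QuotientGroup.Quotient.group _

/-- Two homomorphisms `Q → G` are identified in `Rep(Q,G)` iff they are conjugate in `G`. -/
instance homConjSetoid (Q G : Type) [Group Q] [Group G] : Setoid (Q →* G) where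
  r f g := ∃ x : G, ∀ q, g q = x⁻¹ * f q * x
  iseqv := by
    refine ⟨fun f => ⟨1, by simp⟩, ?_, ?_⟩
    · rintro f g ⟨x, hx⟩
      exact ⟨x⁻¹, fun q => by simp [hx q, mul_assoc]⟩
    · rintro f g h ⟨x, hx⟩ ⟨y, hy⟩
      exact ⟨x * y, fun q => by simp [hx q, hy q, mul_assoc]⟩

/-- `Rep(Q,G) = Hom(Q,G)/G`: conjugacy classes of homomorphisms `Q → G`. -/
def RepCl (Q G : Type) [Group Q] [Group G] : Type := Quotient (homConjSetoid Q G)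

/-- `Out Q` acts on `Rep(Q,G)` by precomposition: `[α] • [f] = [f ∘ α⁻¹]`. -/
instance (Q G : Type) [Group Q] [Group G] : SMul (Out Q) (RepCl Q G) where
  smul o c :=
    Quotient.liftOn' o
      (fun α : MulAut Q =>
        Quotient.map (fun f : Q →* G => f.comp (α⁻¹ : MulAut Q).toMonoidHom)
          (by rintro f g ⟨x, hx⟩; exact ⟨x, fun q => hx _⟩) c)
      (by
        rintro α β h
        rw [QuotientGroup.leftRel_apply] at h
        obtain ⟨q, hq⟩ := h
        induction c using Quotient.inductionOn with
        | h f =>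
          apply Quotient.sound
          refine ⟨f q, fun z => ?_⟩
          have hβ : β⁻¹ = (MulAut.conj q)⁻¹ * α⁻¹ := by
            rw [hq]; group
          simp only [MonoidHom.comp_apply, MulEquiv.coe_toMonoidHom, hβ]
          have : ((MulAut.conj q)⁻¹ * α⁻¹) z = q⁻¹ * (α⁻¹ z) * q := by
            simp [MulAut.conj_inv_apply]
          rw [this]
          simp [map_mul, map_inv])

instance (Q G : Type) [Group Q] [Group G] : MulAction (Out Q) (RepCl Q G) where
  one_smul c := by
    induction c using Quotient.inductionOn with
    | h f => apply Quotient.sound; exact ⟨1, fun q => by simp [MonoidHom.comp_apply]⟩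
  mul_smul o₁ o₂ c := by
    induction o₁ using Quotient.inductionOn' with
    | h α =>
      induction o₂ using Quotient.inductionOn' with
      | h β =>
        induction c using Quotient.inductionOn with
        | h f =>
          apply Quotient.sound
          exact ⟨1, fun q => by simp [MonoidHom.comp_apply, mul_inv_rev]⟩

/-- A class in `Rep(Q,G)` lies in `Inj(Q,G)` iff it is the class of an injective homomorphism. -/
def IsInjClass {Q G : Type} [Group Q] [Group G] (c : RepCl Q G) : Prop :=
  ∃ f : Q →* G, Function.Injective f ∧ (⟦f⟧ : RepCl Q G) = c

/-- `Inj(Q,G) ⊆ Rep(Q,G)`: classes of injective homomorphisms. -/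
def InjCl (Q G : Type) [Group Q] [Group G] : Type := {c : RepCl Q G // IsInjClass c}

instance (Q G : Type) [Group Q] [Group G] : SMul (Out Q) (InjCl Q G) where
  smul o c := ⟨o • c.1, by
    obtain ⟨c₁, f, hf, rfl⟩ := c
    induction o using Quotient.inductionOn' with
    | h α =>
      exact ⟨f.comp (α⁻¹ : MulAut Q).toMonoidHom,
        hf.comp (α⁻¹ : MulAut Q).injective, rfl⟩⟩

instance (Q G : Type) [Group Q] [Group G] : MulAction (Out Q) (InjCl Q G) where
  one_smul c := Subtype.ext (one_smul _ c.1)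
  mul_smul o₁ o₂ c := Subtype.ext (mul_smul o₁ o₂ c.1)

theorem LinearMap.finite_of_finite (R X M : Type) [Ring R] [AddCommGroup X] [Module R X]
    [AddCommGroup M] [Module R M] [Finite X] [Finite M] : Finite (X →ₗ[R] M) :=
  Finite.of_injective (fun f : X →ₗ[R] M => (f : X → M)) DFunLike.coe_injective

/-- Every linear map factors uniquely as an injective map out of a quotient of its source. -/
noncomputable def linearMapEquivSigmaInjective (R X M : Type) [Ring R] [AddCommGroup X] [Module R X]
    [AddCommGroup M] [Module R M] :
    (X →ₗ[R] M) ≃ Σ K : Submodule R X, {f : (X ⧸ K) →ₗ[R] M // Function.Injective f} where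
  toFun f := ⟨LinearMap.ker f, (LinearMap.ker f).liftQ f le_rfl,
    LinearMap.ker_eq_bot.1 (Submodule.ker_liftQ_eq_bot _ _ _ le_rfl)⟩
  invFun s := s.2.1 ∘ₗ s.1.mkQ
  left_inv f := by ext; simp
  right_inv := by
    rintro ⟨K, f, hf⟩
    have hK : LinearMap.ker (f ∘ₗ K.mkQ) = K := by
      rw [LinearMap.ker_comp, LinearMap.ker_eq_bot.2 hf]
      exact Submodule.ker_mkQ K
    have key : ∀ (L : Submodule R X) (h : L = K) (hL : L ≤ LinearMap.ker (f ∘ₗ K.mkQ))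
        (hi : Function.Injective (L.liftQ (f ∘ₗ K.mkQ) hL)),
        (⟨L, L.liftQ (f ∘ₗ K.mkQ) hL, hi⟩ :
          Σ K : Submodule R X, {f : (X ⧸ K) →ₗ[R] M // Function.Injective f}) = ⟨K, f, hf⟩ := by
      rintro L rfl hL hi
      congr 2
      ext x
      simp
    exact key _ hK _ _

/-- Finite modules receiving equally many linear maps from every finite module also receive equally
many injective linear maps from every finite module. -/
theorem card_injective_linearMap_eq {R M N : Type} [Ring R] [AddCommGroup M] [Module R M]
    [AddCommGroup N] [Module R N] [Finite M] [Finite N]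
    (h : ∀ (X : Type) [AddCommGroup X] [Module R X] [Finite X],
      Nat.card (X →ₗ[R] M) = Nat.card (X →ₗ[R] N))
    (X : Type) [AddCommGroup X] [Module R X] [Finite X] :
    Nat.card {f : X →ₗ[R] M // Function.Injective f} =
      Nat.card {f : X →ₗ[R] N // Function.Injective f} := by
  classical
  induction hn : Nat.card X using Nat.strong_induction_on generalizing X with
  | h n ih =>
  have (K : Submodule R X) : Finite (X ⧸ K) := Finite.of_surjective _ K.mkQ_surjective
  have (K : Submodule R X) := LinearMap.finite_of_finite R (X ⧸ K) M
  have (K : Submodule R X) := LinearMap.finite_of_finite R (X ⧸ K) N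
  have : Finite (Submodule R X) :=
    Finite.of_injective (fun K : Submodule R X => (K : Set X)) SetLike.coe_injective
  have := Fintype.ofFinite (Submodule R X)
  have hX := h X
  rw [Nat.card_congr (linearMapEquivSigmaInjective R X M),
    Nat.card_congr (linearMapEquivSigmaInjective R X N), Nat.card_sigma, Nat.card_sigma,
    ← Finset.add_sum_erase _ _ (Finset.mem_univ (⊥ : Submodule R X)),
    ← Finset.add_sum_erase _ _ (Finset.mem_univ (⊥ : Submodule R X))] at hX
  have hsum : ∀ K ∈ Finset.univ.erase (⊥ : Submodule R X),
      Nat.card {f : (X ⧸ K) →ₗ[R] M // Function.Injective f} =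
        Nat.card {f : (X ⧸ K) →ₗ[R] N // Function.Injective f} := by
    intro K hK
    refine ih _ (hn ▸ ?_) (X ⧸ K) rfl
    have hne : ¬ Function.Injective K.mkQ := fun hi =>
      Finset.ne_of_mem_erase hK (by rw [← K.ker_mkQ, LinearMap.ker_eq_bot.2 hi])
    refine lt_of_le_of_ne (Nat.card_le_card_of_surjective _ K.mkQ_surjective) fun he => hne ?_
    exact ((Nat.bijective_iff_surjective_and_card _).2 ⟨K.mkQ_surjective, he.symm⟩).1
  rw [Finset.sum_congr rfl hsum] at hX
  have e (P : Type) [AddCommGroup P] [Module R P] :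
      {f : (X ⧸ (⊥ : Submodule R X)) →ₗ[R] P // Function.Injective f} ≃
        {f : X →ₗ[R] P // Function.Injective f} :=
    ((Submodule.quotEquivOfEqBot ⊥ rfl).arrowCongrAddEquiv (LinearEquiv.refl R P)).toEquiv.subtypeEquiv
      fun f => by
        change _ ↔ Function.Injective (f ∘ (Submodule.quotEquivOfEqBot ⊥ rfl).symm)
        rw [EquivLike.injective_comp]
  rw [← Nat.card_congr (e M), ← Nat.card_congr (e N)]
  exact Nat.add_right_cancel hX

/-- Cancellation of finite modules in direct sums. -/
theorem LinearEquiv.nonempty_of_prod {R M M' N N' : Type} [Ring R]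
    [AddCommGroup M] [Module R M] [AddCommGroup M'] [Module R M']
    [AddCommGroup N] [Module R N] [AddCommGroup N'] [Module R N']
    [Finite M] [Finite M'] [Finite N]
    (e : (M × N) ≃ₗ[R] (M' × N')) (f : N ≃ₗ[R] N') : Nonempty (M ≃ₗ[R] M') := by
  have h (X : Type) [AddCommGroup X] [Module R X] [Finite X] :
      Nat.card (X →ₗ[R] M) = Nat.card (X →ₗ[R] M') := by
    have := LinearMap.finite_of_finite R X N
    have h1 : Nat.card ((X →ₗ[R] M) × (X →ₗ[R] N)) = Nat.card ((X →ₗ[R] M') × (X →ₗ[R] N)) :=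
      Nat.card_congr <| (LinearMap.prodEquiv ℕ).toEquiv.trans <|
        ((LinearEquiv.refl R X).arrowCongrAddEquiv
          (e.trans ((LinearEquiv.refl R M').prodCongr f.symm))).toEquiv.trans
        (LinearMap.prodEquiv ℕ).toEquiv.symm
    rw [Nat.card_prod, Nat.card_prod] at h1
    exact Nat.eq_of_mul_eq_mul_right Nat.card_pos h1
  have inj := card_injective_linearMap_eq h
  have ex {P P' : Type} [AddCommGroup P] [Module R P] [AddCommGroup P'] [Module R P'] [Finite P]
      [Finite P'] (h : Nat.card {f : P →ₗ[R] P // Function.Injective f} =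
        Nat.card {f : P →ₗ[R] P' // Function.Injective f}) :
      ∃ g : P →ₗ[R] P', Function.Injective g := by
    have := LinearMap.finite_of_finite R P P
    have : Nonempty {f : P →ₗ[R] P // Function.Injective f} := ⟨LinearMap.id, fun _ _ h => h⟩
    obtain ⟨⟨g, hg⟩⟩ := (Nat.card_pos_iff.1 (h ▸ Nat.card_pos)).1
    exact ⟨g, hg⟩
  obtain ⟨g, hg⟩ := ex (inj M)
  obtain ⟨g', hg'⟩ := ex (inj M').symm
  exact ⟨LinearEquiv.ofBijective g ((Nat.bijective_iff_injective_and_card _).2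
    ⟨hg, (Nat.card_le_card_of_injective g hg).antisymm (Nat.card_le_card_of_injective g' hg')⟩)⟩

/-- The permutation modules `k[X]` and `k[Y]` of two sets with an action of `H` are isomorphic. -/
def PermIso (k H X Y : Type) [CommRing k] [SMul H X] [SMul H Y] : Prop :=
  ∃ e : (X →₀ k) ≃ₗ[k] (Y →₀ k),
    ∀ (h : H) (v : X →₀ k), e (v.mapDomain (h • ·)) = (e v).mapDomain (h • ·)

/-- The permutation representation on finitely supported functions. -/
noncomputable def finsuppPermRep (k H X : Type) [CommRing k] [Group H] [MulAction H X] :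
    Representation k H (X →₀ k) where
  toFun h := Finsupp.lmapDomain k k (h • ·)
  map_one' := by ext; simp
  map_mul' g h := by ext; simp [mul_smul]

/-- The permutation module over the group algebra, on finitely supported functions. -/
noncomputable abbrev finsuppPermModule (k H X : Type) [CommRing k] [Group H] [MulAction H X] :
    Module (MonoidAlgebra k H) (X →₀ k) :=
  Module.compHom _ (finsuppPermRep k H X).asAlgebraHom.toRingHom

theorem nonempty_rep_iso_iff_permIso (k H X Y : Type) [CommRing k] [Group H] [MulAction H X]
    [MulAction H Y] :
    Nonempty (Rep.ofMulAction k H X ≅ Rep.ofMulAction k H Y) ↔ PermIso k H X Y := by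
  let cX : MonoidAlgebra k X ≃ₗ[k] (X →₀ k) := MonoidAlgebra.coeffLinearEquiv k
  let cY : MonoidAlgebra k Y ≃ₗ[k] (Y →₀ k) := MonoidAlgebra.coeffLinearEquiv k
  have hX (h : H) (v : MonoidAlgebra k X) :
      cX (Representation.ofMulAction k H X h v) = (cX v).mapDomain (h • ·) := by
    rw [Representation.ofMulAction_def]; rfl
  have hY (h : H) (v : MonoidAlgebra k Y) :
      cY (Representation.ofMulAction k H Y h v) = (cY v).mapDomain (h • ·) := by
    rw [Representation.ofMulAction_def]; rfl
  constructor
  · rintro ⟨i⟩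
    let e : (Representation.ofMulAction k H X).Equiv (Representation.ofMulAction k H Y) :=
      Representation.equivOfIso i
    refine ⟨(cX.symm.trans e.toLinearEquiv).trans cY, fun h v => ?_⟩
    obtain ⟨w, rfl⟩ := cX.surjective v
    have he : e.toLinearEquiv (Representation.ofMulAction k H X h w) =
        Representation.ofMulAction k H Y h (e.toLinearEquiv w) :=
      LinearMap.congr_fun (e.isIntertwining' h) w
    simp only [LinearEquiv.trans_apply, LinearEquiv.symm_apply_apply]
    rw [← hX, LinearEquiv.symm_apply_apply, he, hY]
  · rintro ⟨e, he⟩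
    refine ⟨Rep.mkIso (Representation.Equiv.mk ((cX.trans e).trans cY.symm) fun h => ?_)⟩
    refine LinearMap.ext fun v => cY.injective ?_
    change cY (cY.symm (e (cX (Representation.ofMulAction k H X h v)))) =
      cY (Representation.ofMulAction k H Y h (cY.symm (e (cX v))))
    rw [hX, he, hY]
    simp

namespace PermIso

variable {k H : Type} [CommRing k]

theorem symm {X Y : Type} [SMul H X] [SMul H Y] (e : PermIso k H X Y) : PermIso k H Y X := by
  obtain ⟨e, he⟩ := e
  exact ⟨e.symm, fun h v => e.injective (by simp [he])⟩

theorem trans {X Y Z : Type} [SMul H X] [SMul H Y] [SMul H Z] (e : PermIso k H X Y)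
    (f : PermIso k H Y Z) : PermIso k H X Z := by
  obtain ⟨e, he⟩ := e
  obtain ⟨f, hf⟩ := f
  exact ⟨e.trans f, fun h v => by simp [he, hf]⟩

theorem of_equiv {X Y : Type} [SMul H X] [SMul H Y] (e : X ≃ Y)
    (he : ∀ (h : H) x, e (h • x) = h • e x) : PermIso k H X Y := by
  refine ⟨Finsupp.domLCongr e, fun h v => ?_⟩
  simp only [Finsupp.domLCongr_apply, Finsupp.domCongr_apply, Finsupp.equivMapDomain_eq_mapDomain,
    ← Finsupp.mapDomain_comp]
  congr 1
  funext x
  exact he h x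

variable [Group H]

theorem sumFinsupp_mapDomain {X Y : Type} [MulAction H X] [MulAction H Y] (h : H) (v : X ⊕ Y →₀ k) :
    Finsupp.sumFinsuppLEquivProdFinsupp k (v.mapDomain (h • ·)) =
      ((Finsupp.sumFinsuppLEquivProdFinsupp k v).1.mapDomain (h • ·),
        (Finsupp.sumFinsuppLEquivProdFinsupp k v).2.mapDomain (h • ·)) := by
  ext x <;> obtain ⟨x, rfl⟩ := MulAction.surjective h x
  · have h1 := Finsupp.mapDomain_apply (MulAction.injective h) v (Sum.inl x)
    rw [Finsupp.mapDomain_apply (MulAction.injective h)]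
    exact h1
  · have h1 := Finsupp.mapDomain_apply (MulAction.injective h) v (Sum.inr x)
    rw [Finsupp.mapDomain_apply (MulAction.injective h)]
    exact h1

theorem sum {X X' Y Y' : Type} [MulAction H X] [MulAction H X'] [MulAction H Y] [MulAction H Y']
    (e : PermIso k H X X') (f : PermIso k H Y Y') : PermIso k H (X ⊕ Y) (X' ⊕ Y') := by
  obtain ⟨e, he⟩ := e
  obtain ⟨f, hf⟩ := f
  refine ⟨((Finsupp.sumFinsuppLEquivProdFinsupp k).trans (e.prodCongr f)).trans
    (Finsupp.sumFinsuppLEquivProdFinsupp k).symm, fun h v =>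
      (Finsupp.sumFinsuppLEquivProdFinsupp k).injective ?_⟩
  rw [sumFinsupp_mapDomain]
  simp only [LinearEquiv.trans_apply, LinearEquiv.apply_symm_apply, sumFinsupp_mapDomain,
    LinearEquiv.prodCongr_apply, he, hf]

/-- An additive equivalence compatible with the actions of monomials is linear over the group
algebra. -/
noncomputable def _root_.AddEquiv.toMonoidAlgebraLinearEquiv {M N : Type}
    [AddCommGroup M] [Module (MonoidAlgebra k H) M]
    [AddCommGroup N] [Module (MonoidAlgebra k H) N] (e : M ≃+ N)
    (he : ∀ (h : H) (c : k) v, e (MonoidAlgebra.single h c • v) = MonoidAlgebra.single h c • e v) :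
    M ≃ₗ[MonoidAlgebra k H] N :=
  e.toLinearEquiv fun r v => by
    induction r using MonoidAlgebra.induction_linear with
    | zero => simp
    | add f g hf hg => simp [add_smul, hf, hg]
    | single h c => exact he h c v

theorem of_sum {X X' Y Y' : Type} [MulAction H X] [MulAction H X'] [MulAction H Y] [MulAction H Y']
    [Finite k] [Finite X] [Finite X'] [Finite Y]
    (e : PermIso k H (X ⊕ Y) (X' ⊕ Y')) (f : PermIso k H Y Y') : PermIso k H X X' := by
  obtain ⟨e, he⟩ := e
  obtain ⟨f, hf⟩ := f
  let _ := finsuppPermModule k H X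
  let _ := finsuppPermModule k H X'
  let _ := finsuppPermModule k H Y
  let _ := finsuppPermModule k H Y'
  have smul_def (Z : Type) [MulAction H Z] (h : H) (c : k) (v : Z →₀ k) :
      letI := finsuppPermModule k H Z
      MonoidAlgebra.single h c • v = c • v.mapDomain (h • ·) := by
    change (finsuppPermRep k H Z).asAlgebraHom (MonoidAlgebra.single h c) v = _
    rw [Representation.asAlgebraHom_single]; rfl
  have : Finite (X →₀ k) := Finite.of_equiv (X → k) Finsupp.equivFunOnFinite.symm
  have : Finite (X' →₀ k) := Finite.of_equiv (X' → k) Finsupp.equivFunOnFinite.symm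
  have : Finite (Y →₀ k) := Finite.of_equiv (Y → k) Finsupp.equivFunOnFinite.symm
  let E : ((X →₀ k) × (Y →₀ k)) ≃ₗ[k] ((X' →₀ k) × (Y' →₀ k)) :=
    ((Finsupp.sumFinsuppLEquivProdFinsupp k).symm.trans e).trans
      (Finsupp.sumFinsuppLEquivProdFinsupp k)
  have hE (h : H) (c : k) (v : (X →₀ k) × (Y →₀ k)) :
      E (c • v.1.mapDomain (h • ·), c • v.2.mapDomain (h • ·)) =
        (c • (E v).1.mapDomain (h • ·), c • (E v).2.mapDomain (h • ·)) := by
    obtain ⟨w, rfl⟩ := (Finsupp.sumFinsuppLEquivProdFinsupp k).surjective v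
    rw [← Prod.smul_mk, ← Prod.smul_mk, ← sumFinsupp_mapDomain, map_smul]
    simp only [E, LinearEquiv.trans_apply, LinearEquiv.symm_apply_apply]
    rw [← sumFinsupp_mapDomain, he]
  have hf' (h : H) (c : k) (v : Y →₀ k) :
      f (c • v.mapDomain (h • ·)) = c • (f v).mapDomain (h • ·) := by
    rw [map_smul, hf]
  let E' : ((X →₀ k) × (Y →₀ k)) ≃ₗ[MonoidAlgebra k H] ((X' →₀ k) × (Y' →₀ k)) :=
    AddEquiv.toMonoidAlgebraLinearEquiv (k := k) E.toAddEquiv fun h c v =>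
      ((congrArg E (Prod.ext (smul_def X h c v.1) (smul_def Y h c v.2))).trans (hE h c v)).trans
        (Prod.ext (smul_def X' h c (E v).1) (smul_def Y' h c (E v).2)).symm
  let F : (Y →₀ k) ≃ₗ[MonoidAlgebra k H] (Y' →₀ k) :=
    AddEquiv.toMonoidAlgebraLinearEquiv (k := k) f.toAddEquiv fun h c v =>
      ((congrArg f (smul_def Y h c v)).trans (hf' h c v)).trans (smul_def Y' h c (f v)).symm
  obtain ⟨g⟩ := LinearEquiv.nonempty_of_prod (R := MonoidAlgebra k H) E' F
  have hg (h : H) (c : k) (v : X →₀ k) :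
      g (c • v.mapDomain (h • ·) : X →₀ k) = (c • (g v : X' →₀ k).mapDomain (h • ·) : X' →₀ k) :=
    ((congrArg g (smul_def X h c v)).symm.trans (g.map_smul _ v)).trans (smul_def X' h c (g v))
  let g' : (X →₀ k) ≃ₗ[k] (X' →₀ k) := AddEquiv.toLinearEquiv g.toAddEquiv fun c v => by
    have h1 (Z : Type) [MulAction H Z] (v : Z →₀ k) : v.mapDomain ((1 : H) • ·) = v := by
      simp_rw [one_smul]
      exact Finsupp.mapDomain_id
    have := hg 1 c v
    rwa [h1, h1] at this
  refine ⟨g', fun h v => ?_⟩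
  have := hg h 1 v
  rwa [one_smul, one_smul] at this

end PermIso

section Fibres

variable {k H X Y I : Type} [CommRing k] [Group H] [MulAction H X] [MulAction H Y] [MulAction H I]

/-- `φ` maps the span of the fibre of `π` over `i` to the span of the fibre of `ρ` over `i`,
equivariantly for the stabilizer of `i`. -/
def IsFibreMap (H : Type) [Group H] [MulAction H X] [MulAction H Y] [MulAction H I]
    (π : X → I) (ρ : Y → I) (i : I) (φ : (X →₀ k) →ₗ[k] (Y →₀ k)) : Prop :=
  ∀ x, π x = i → φ (Finsupp.single x 1) ∈ Finsupp.supported k k (ρ ⁻¹' {i}) ∧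
    ∀ h : H, h • i = i →
      φ (Finsupp.single (h • x) 1) = (φ (Finsupp.single x 1)).mapDomain (h • ·)

theorem mapDomain_smul_smul (g h : H) (v : Y →₀ k) :
    (v.mapDomain (h • ·)).mapDomain (g • ·) = v.mapDomain ((g * h) • ·) := by
  rw [← Finsupp.mapDomain_comp]
  simp [Function.comp_def, mul_smul]

/-- Fibre maps extend to a globally equivariant map that agrees with them on the fibres over chosen
orbit representatives. -/
theorem exists_equivariant_extension {π : X → I} {ρ : Y → I}
    (hπ : ∀ (h : H) x, π (h • x) = h • π x) (φ : I → (X →₀ k) →ₗ[k] (Y →₀ k))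
    (hφ : ∀ i, IsFibreMap H π ρ i (φ i)) (rep : I → I) (tr : I → H)
    (htr : ∀ i, tr i • rep i = i) (hrep : ∀ (h : H) i, rep (h • i) = rep i) :
    ∃ Φ : (X →₀ k) →ₗ[k] (Y →₀ k),
      (∀ (h : H) v, Φ (v.mapDomain (h • ·)) = (Φ v).mapDomain (h • ·)) ∧
      ∀ i, ∀ v ∈ Finsupp.supported k k (π ⁻¹' {rep i}), Φ v = φ (rep i) v := by
  let F (x : X) : Y →₀ k :=
    (φ (rep (π x)) (Finsupp.single ((tr (π x))⁻¹ • x) 1)).mapDomain (tr (π x) • ·)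
  have base (x : X) : π ((tr (π x))⁻¹ • x) = rep (π x) := by
    rw [hπ, inv_smul_eq_iff, htr]
  have hF (h : H) (x : X) : F (h • x) = (F x).mapDomain (h • ·) := by
    let s : H := (tr (h • π x))⁻¹ * h * tr (π x)
    have hs : s • rep (π x) = rep (π x) := by
      simp only [s, mul_smul, htr]
      rw [inv_smul_eq_iff, ← hrep h, htr]
    have h1 : (tr (h • π x))⁻¹ • h • x = s • (tr (π x))⁻¹ • x := by
      simp [s, mul_smul]
    simp only [F, hπ, hrep, h1]
    rw [((hφ _) _ (base x)).2 s hs, mapDomain_smul_smul, mapDomain_smul_smul]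
    simp [s, mul_assoc]
  let Φ : (X →₀ k) →ₗ[k] (Y →₀ k) := Finsupp.linearCombination k F
  have hΦ (x : X) : Φ (Finsupp.single x 1) = F x := by simp [Φ]
  refine ⟨Φ, fun h v => ?_, fun i v hv => ?_⟩
  · induction v using Finsupp.induction_linear with
    | zero => simp
    | add f g hf hg => simp only [Finsupp.mapDomain_add, map_add, hf, hg]
    | single x c =>
      rw [← mul_one c, ← smul_eq_mul, ← Finsupp.smul_single, Finsupp.mapDomain_smul, map_smul,
        map_smul, Finsupp.mapDomain_smul, Finsupp.mapDomain_single, hΦ, hΦ, hF]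
  · rw [Finsupp.supported_eq_span_single] at hv
    refine LinearMap.eqOn_span (f := Φ) (g := φ (rep i)) ?_ hv
    rintro _ ⟨x, hx, rfl⟩
    have hx : π x = rep i := hx
    have hri : rep (rep i) = rep i := by
      conv_lhs => rw [← hrep (tr i), htr]
    have hfix : tr (rep i) • rep i = rep i := by
      have := htr (rep i)
      rwa [hri] at this
    simp only [hΦ, F, hx, hri]
    rw [((hφ _) x hx).2 _ (inv_smul_eq_iff.2 hfix.symm), mapDomain_smul_smul]
    simp only [mul_inv_cancel, one_smul]
    exact Finsupp.mapDomain_id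

/-- A linear isomorphism of permutation modules, transported along parametrizations of the fibres
over `i`, is a fibre map. -/
theorem isFibreMap_of_embedding {S Z W : Type} [SMul S Z] [SMul S W] {π : X → I} {ρ : Y → I} {i : I}
    {ι : Z → X} {κ : W → Y} (hι : Function.Injective ι)
    (hιr : ∀ x, π x = i → ∃ z, ι z = x) (hκr : ∀ w, ρ (κ w) = i)
    (hS : ∀ h : H, h • i = i →
      ∃ s : S, (∀ z, ι (s • z) = h • ι z) ∧ ∀ w, κ (s • w) = h • κ w)
    (e : (Z →₀ k) →ₗ[k] (W →₀ k))
    (he : ∀ (s : S) v, e (v.mapDomain (s • ·)) = (e v).mapDomain (s • ·)) :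
    IsFibreMap H π ρ i (Finsupp.lmapDomain k k κ ∘ₗ e ∘ₗ Finsupp.lcomapDomain ι hι) := by
  have hcomp (z : Z) : (Finsupp.lmapDomain k k κ ∘ₗ e ∘ₗ Finsupp.lcomapDomain ι hι)
      (Finsupp.single (ι z) 1) = (e (Finsupp.single z 1)).mapDomain κ := by
    have : Finsupp.lcomapDomain (R := k) ι hι (Finsupp.single (ι z) (1 : k)) = Finsupp.single z 1 := by
      rw [← Finsupp.mapDomain_single]
      exact Finsupp.comapDomain_mapDomain _ hι _
    simp [this]
  intro x hx
  obtain ⟨z, rfl⟩ := hιr x hx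
  refine ⟨?_, fun h hh => ?_⟩
  · rw [hcomp, Finsupp.mem_supported]
    classical
    intro y hy
    obtain ⟨w, -, rfl⟩ := Finset.mem_image.1 (Finsupp.mapDomain_support hy)
    exact hκr w
  · obtain ⟨s, hsz, hsw⟩ := hS h hh
    rw [← hsz, hcomp, hcomp, ← Finsupp.mapDomain_single (f := (s • · : Z → Z)), he,
      ← Finsupp.mapDomain_comp, ← Finsupp.mapDomain_comp]
    congr 1
    exact funext hsw

/-- Equivariant gluing: if the fibres over each point of the base have isomorphic permutation
modules over the stabilizer, then the total spaces have isomorphic permutation modules. -/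
theorem PermIso.of_fibres {π : X → I} {ρ : Y → I}
    (hπ : ∀ (h : H) x, π (h • x) = h • π x) (hρ : ∀ (h : H) y, ρ (h • y) = h • ρ y)
    (hf : ∀ i, ∃ (φ : (X →₀ k) →ₗ[k] (Y →₀ k)) (ψ : (Y →₀ k) →ₗ[k] (X →₀ k)),
      IsFibreMap H π ρ i φ ∧ IsFibreMap H ρ π i ψ ∧
      (∀ x, π x = i → ψ (φ (Finsupp.single x 1)) = Finsupp.single x 1) ∧
      (∀ y, ρ y = i → φ (ψ (Finsupp.single y 1)) = Finsupp.single y 1)) :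
    PermIso k H X Y := by
  choose φ ψ hφ hψ hψφ hφψ using hf
  let rep (i : I) : I := (Quotient.mk (MulAction.orbitRel H I) i).out
  have hex (i : I) : ∃ h : H, h • rep i = i := by
    have : MulAction.orbitRel H I (rep i) i := Quotient.mk_out i
    exact (MulAction.orbitRel H I).symm this
  choose tr htr using hex
  have hrep (h : H) (i : I) : rep (h • i) = rep i := by
    have : Quotient.mk (MulAction.orbitRel H I) (h • i) = Quotient.mk (MulAction.orbitRel H I) i :=
      Quotient.sound ⟨h, rfl⟩
    simp only [rep, this]
  obtain ⟨Φ, hΦ, hΦr⟩ := exists_equivariant_extension hπ φ hφ rep tr htr hrep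
  obtain ⟨Ψ, hΨ, hΨr⟩ := exists_equivariant_extension hρ ψ hψ rep tr htr hrep
  have single_mem {Z : Type} (τ : Z → I) (z : Z) :
      Finsupp.single z (1 : k) ∈ Finsupp.supported k k (τ ⁻¹' {τ z}) :=
    Finsupp.single_mem_supported k 1 rfl
  refine ⟨LinearEquiv.ofLinearMap Φ Ψ ?_ ?_, hΦ⟩
  · refine Finsupp.lhom_ext' fun y => LinearMap.ext_ring ?_
    have hb : ρ ((tr (ρ y))⁻¹ • y) = rep (ρ y) := by rw [hρ, inv_smul_eq_iff, htr]
    have hy : Finsupp.single y (1 : k) =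
        (Finsupp.single ((tr (ρ y))⁻¹ • y) 1).mapDomain (tr (ρ y) • ·) := by
      simp [Finsupp.mapDomain_single]
    change Φ (Ψ (Finsupp.single y 1)) = Finsupp.single y 1
    rw [hy, hΨ, hΦ, hΨr (ρ y) _ (hb ▸ single_mem ρ _), hΦr (ρ y) _ (hψ _ _ hb).1, hφψ _ _ hb]
  · refine Finsupp.lhom_ext' fun x => LinearMap.ext_ring ?_
    have hb : π ((tr (π x))⁻¹ • x) = rep (π x) := by rw [hπ, inv_smul_eq_iff, htr]
    have hx : Finsupp.single x (1 : k) =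
        (Finsupp.single ((tr (π x))⁻¹ • x) 1).mapDomain (tr (π x) • ·) := by
      simp [Finsupp.mapDomain_single]
    change Ψ (Φ (Finsupp.single x 1)) = Finsupp.single x 1
    rw [hx, hΦ, hΨ, hΦr (π x) _ (hb ▸ single_mem π _), hΨr (π x) _ (hφ _ _ hb).1, hψφ _ _ hb]

/-- Equivariant gluing, with parametrized fibres. -/
theorem PermIso.of_fibre_embeddings {π : X → I} {ρ : Y → I}
    (hπ : ∀ (h : H) x, π (h • x) = h • π x) (hρ : ∀ (h : H) y, ρ (h • y) = h • ρ y)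
    (hf : ∀ i, (∃ x, π x = i) ∨ (∃ y, ρ y = i) →
      ∃ (S Z W : Type) (_ : SMul S Z) (_ : SMul S W) (ι : Z → X) (κ : W → Y),
      Function.Injective ι ∧ Function.Injective κ ∧
      (∀ x, π x = i ↔ ∃ z, ι z = x) ∧ (∀ y, ρ y = i ↔ ∃ w, κ w = y) ∧
      (∀ h : H, h • i = i → ∃ s : S, (∀ z, ι (s • z) = h • ι z) ∧ ∀ w, κ (s • w) = h • κ w) ∧
      PermIso k S Z W) :
    PermIso k H X Y := by
  refine PermIso.of_fibres hπ hρ fun i => ?_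
  by_cases hi : (∃ x, π x = i) ∨ (∃ y, ρ y = i)
  · obtain ⟨S, Z, W, _, _, ι, κ, hι, hκ, hιr, hκr, hS, e, he⟩ := hf i hi
    have he' (s : S) (v : W →₀ k) :
        e.symm (v.mapDomain (s • ·)) = (e.symm v).mapDomain (s • ·) :=
      e.injective (by simp [he])
    have hcι (v : Z →₀ k) : Finsupp.lcomapDomain (R := k) ι hι (v.mapDomain ι) = v :=
      Finsupp.comapDomain_mapDomain _ hι v
    have hcκ (v : W →₀ k) : Finsupp.lcomapDomain (R := k) κ hκ (v.mapDomain κ) = v :=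
      Finsupp.comapDomain_mapDomain _ hκ v
    refine ⟨_, _, isFibreMap_of_embedding hι (fun x => (hιr x).1) (fun w => (hκr _).2 ⟨w, rfl⟩) hS
        e.toLinearMap he,
      isFibreMap_of_embedding hκ (fun y => (hκr y).1) (fun z => (hιr _).2 ⟨z, rfl⟩)
        (fun h hh => (hS h hh).imp fun _ h => h.symm) e.symm.toLinearMap he', ?_, ?_⟩
    · intro x hx
      obtain ⟨z, rfl⟩ := (hιr x).1 hx
      rw [← Finsupp.mapDomain_single]
      simp only [LinearMap.comp_apply, Finsupp.lmapDomain_apply, LinearEquiv.coe_coe, hcι, hcκ,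
        LinearEquiv.symm_apply_apply]
    · intro y hy
      obtain ⟨w, rfl⟩ := (hκr y).1 hy
      rw [← Finsupp.mapDomain_single]
      simp only [LinearMap.comp_apply, Finsupp.lmapDomain_apply, LinearEquiv.coe_coe, hcι, hcκ,
        LinearEquiv.apply_symm_apply]
  · push Not at hi
    exact ⟨0, 0, fun x hx => absurd hx (hi.1 x), fun y hy => absurd hy (hi.2 y),
      fun x hx => absurd hx (hi.1 x), fun y hy => absurd hy (hi.2 y)⟩

end Fibres

section Representations

variable {Q G : Type} [Group Q] [Group G]

/-- The class in `Out Q` of an automorphism of `Q`. -/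
def Out.mk (α : MulAut Q) : Out Q := QuotientGroup.mk' (Inn Q) α

theorem Out.mk_surjective (o : Out Q) : ∃ α : MulAut Q, Out.mk α = o :=
  QuotientGroup.mk'_surjective (Inn Q) o

/-- The conjugacy class of a homomorphism. -/
def RepCl.mk (f : Q →* G) : RepCl Q G := Quotient.mk _ f

theorem RepCl.mk_surjective (c : RepCl Q G) : ∃ f, RepCl.mk f = c := Quotient.exists_rep c

theorem Out.mk_smul_mk (α : MulAut Q) (f : Q →* G) :
    Out.mk α • RepCl.mk f = RepCl.mk (f.comp (α⁻¹ : MulAut Q).toMonoidHom) := rfl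

/-- The automorphism group acts on any set with an action of the outer automorphism group. -/
abbrev mulAutAction (X : Type) [MulAction (Out Q) X] : MulAction (MulAut Q) X where
  smul α x := Out.mk α • x
  one_smul x := one_smul (Out Q) x
  mul_smul α β x := mul_smul (Out.mk α) (Out.mk β) x

/-- The kernel of a conjugacy class of homomorphisms. -/
def RepCl.ker (c : RepCl Q G) : Subgroup Q :=
  Quotient.lift MonoidHom.ker (by
    rintro f g ⟨x, hx⟩
    ext q
    simp only [MonoidHom.mem_ker, hx]
    constructor
    · intro h
      simp [h]
    · intro h
      have h1 : f q * x = x := by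
        rw [mul_assoc] at h
        exact (inv_mul_eq_one.1 h).symm
      simpa using h1) c

theorem RepCl.ker_mk (f : Q →* G) : (RepCl.mk f).ker = f.ker := rfl

open scoped Pointwise in
theorem RepCl.ker_smul (α : MulAut Q) (c : RepCl Q G) : (Out.mk α • c).ker = α • c.ker := by
  obtain ⟨f, rfl⟩ := c.mk_surjective
  rw [Out.mk_smul_mk, RepCl.ker_mk, RepCl.ker_mk]
  ext q
  rw [Subgroup.mem_pointwise_smul_iff_inv_smul_mem]
  rfl

theorem isInjClass_iff_ker {c : RepCl Q G} : IsInjClass c ↔ c.ker = ⊥ := by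
  constructor
  · rintro ⟨f, hf, rfl⟩
    exact (MonoidHom.ker_eq_bot_iff f).2 hf
  · obtain ⟨f, rfl⟩ := c.mk_surjective
    exact fun h => ⟨f, (MonoidHom.ker_eq_bot_iff f).1 h, rfl⟩

theorem isInjClass_smul_iff {o : Out Q} {c : RepCl Q G} : IsInjClass (o • c) ↔ IsInjClass c := by
  obtain ⟨α, rfl⟩ := Out.mk_surjective o
  open scoped Pointwise in
  rw [isInjClass_iff_ker, isInjClass_iff_ker, RepCl.ker_smul, smul_eq_iff_eq_inv_smul,
    Subgroup.smul_bot]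

/-- The classes of non-injective homomorphisms. -/
def NonInjCl (Q G : Type) [Group Q] [Group G] : Type := {c : RepCl Q G // ¬ IsInjClass c}

instance NonInjCl.instMulAction : MulAction (Out Q) (NonInjCl Q G) where
  smul o c := ⟨o • c.1, fun h => c.2 (isInjClass_smul_iff.1 h)⟩
  one_smul c := Subtype.ext (one_smul _ c.1)
  mul_smul o₁ o₂ c := Subtype.ext (mul_smul o₁ o₂ c.1)

instance RepCl.instFinite [Finite Q] [Finite G] : Finite (RepCl Q G) :=
  have : Finite (Q →* G) := Finite.of_injective (fun f => (f : Q → G)) DFunLike.coe_injective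
  inferInstanceAs (Finite (Quotient (homConjSetoid Q G)))

instance InjCl.instFinite [Finite Q] [Finite G] : Finite (InjCl Q G) :=
  inferInstanceAs (Finite {c : RepCl Q G // IsInjClass c})

instance NonInjCl.instFinite [Finite Q] [Finite G] : Finite (NonInjCl Q G) :=
  inferInstanceAs (Finite {c : RepCl Q G // ¬ IsInjClass c})

theorem permIso_injCl_sum_nonInjCl (k : Type) [CommRing k] :
    PermIso k (Out Q) (InjCl Q G ⊕ NonInjCl Q G) (RepCl Q G) := by
  classical
  refine PermIso.of_equiv (Equiv.sumCompl IsInjClass) ?_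
  rintro o (c | c) <;> rfl

/-- Inflation of conjugacy classes of homomorphisms along a quotient map. -/
def RepCl.inflate (K : Subgroup Q) [K.Normal] (c : RepCl (Q ⧸ K) G) : RepCl Q G :=
  Quotient.map (fun f : Q ⧸ K →* G => f.comp (QuotientGroup.mk' K))
    (by rintro f g ⟨x, hx⟩; exact ⟨x, fun q => hx _⟩) c

theorem RepCl.inflate_injective (K : Subgroup Q) [K.Normal] :
    Function.Injective (RepCl.inflate K : RepCl (Q ⧸ K) G → RepCl Q G) := by
  intro c d h
  obtain ⟨f, rfl⟩ := c.mk_surjective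
  obtain ⟨g, rfl⟩ := d.mk_surjective
  obtain ⟨x, hx⟩ := Quotient.exact h
  refine Quotient.sound ⟨x, fun q => ?_⟩
  obtain ⟨q, rfl⟩ := QuotientGroup.mk'_surjective K q
  exact hx q

theorem RepCl.ker_eq_iff_exists_inflate (K : Subgroup Q) [K.Normal] (c : RepCl Q G) :
    c.ker = K ↔ ∃ d : InjCl (Q ⧸ K) G, RepCl.inflate K d.1 = c := by
  constructor
  · obtain ⟨f, rfl⟩ := c.mk_surjective
    rintro rfl
    exact ⟨⟨_, QuotientGroup.kerLift f, QuotientGroup.kerLift_injective f, rfl⟩, rfl⟩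
  · rintro ⟨⟨_, f, hf, rfl⟩, rfl⟩
    change (f.comp (QuotientGroup.mk' K)).ker = K
    rw [← MonoidHom.comap_ker, (MonoidHom.ker_eq_bot_iff f).2 hf, MonoidHom.comap_bot,
      QuotientGroup.ker_mk']

open scoped Pointwise in
/-- An automorphism stabilizing a normal subgroup acts compatibly with inflation. -/
theorem exists_out_quotient_smul (K : Subgroup Q) [K.Normal] (α : MulAut Q) (hα : α • K = K) :
    ∃ o : Out (Q ⧸ K), ∀ (G : Type) [Group G] (c : RepCl (Q ⧸ K) G),
      RepCl.inflate K (o • c) = Out.mk α • RepCl.inflate K c := by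
  refine ⟨Out.mk (QuotientGroup.congr K K α hα), fun G _ c => ?_⟩
  obtain ⟨f, rfl⟩ := c.mk_surjective
  refine Quotient.sound ⟨1, fun q => ?_⟩
  rw [inv_one, one_mul, mul_one]
  rfl

theorem RepCl.ker_normal (c : RepCl Q G) : c.ker.Normal := by
  obtain ⟨f, rfl⟩ := c.mk_surjective
  exact inferInstanceAs f.ker.Normal

open scoped Pointwise in
theorem permIso_nonInjCl {k G₁ G₂ : Type} [CommRing k] [Group G₁] [Group G₂]
    (h : ∀ (K : Subgroup Q) [K.Normal], K ≠ ⊥ →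
      PermIso k (Out (Q ⧸ K)) (InjCl (Q ⧸ K) G₁) (InjCl (Q ⧸ K) G₂)) :
    PermIso k (Out Q) (NonInjCl Q G₁) (NonInjCl Q G₂) := by
  let _ : MulAction (MulAut Q) (NonInjCl Q G₁) := mulAutAction _
  let _ : MulAction (MulAut Q) (NonInjCl Q G₂) := mulAutAction _
  suffices PermIso k (MulAut Q) (NonInjCl Q G₁) (NonInjCl Q G₂) by
    obtain ⟨e, he⟩ := this
    refine ⟨e, fun o v => ?_⟩
    obtain ⟨α, rfl⟩ := Out.mk_surjective o
    exact he α v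
  refine PermIso.of_fibre_embeddings (π := fun c => c.1.ker) (ρ := fun c => c.1.ker)
    (fun α c => RepCl.ker_smul α c.1) (fun α c => RepCl.ker_smul α c.1) fun K hK => ?_
  have hn : K.Normal := by
    obtain ⟨c, rfl⟩ | ⟨c, rfl⟩ := hK <;> exact c.1.ker_normal
  have hb : K ≠ ⊥ := by
    obtain ⟨c, rfl⟩ | ⟨c, rfl⟩ := hK <;> exact fun h => c.2 (isInjClass_iff_ker.2 h)
  have hker {G : Type} [Group G] (d : InjCl (Q ⧸ K) G) : (RepCl.inflate K d.1).ker = K :=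
    (RepCl.ker_eq_iff_exists_inflate K _).2 ⟨d, rfl⟩
  let ι (G : Type) [Group G] (d : InjCl (Q ⧸ K) G) : NonInjCl Q G :=
    ⟨RepCl.inflate K d.1, fun h => hb ((hker d).symm.trans (isInjClass_iff_ker.1 h))⟩
  have hι (G : Type) [Group G] : Function.Injective (ι G) := fun c d h =>
    Subtype.ext (RepCl.inflate_injective K (congrArg Subtype.val h))
  have hιr (G : Type) [Group G] (c : NonInjCl Q G) : c.1.ker = K ↔ ∃ d, ι G d = c :=
    (RepCl.ker_eq_iff_exists_inflate K c.1).trans (exists_congr fun _ =>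
      ⟨fun h => Subtype.ext h, fun h => congrArg Subtype.val h⟩)
  refine ⟨Out (Q ⧸ K), InjCl (Q ⧸ K) G₁, InjCl (Q ⧸ K) G₂, inferInstance, inferInstance,
    ι G₁, ι G₂, hι G₁, hι G₂, hιr G₁, hιr G₂, fun α hα => ?_, h K hb⟩
  obtain ⟨o, ho⟩ := exists_out_quotient_smul K α hα
  exact ⟨o, fun c => Subtype.ext (ho G₁ c.1), fun c => Subtype.ext (ho G₂ c.1)⟩

end Representations

/-- **Martino–Priddy, Theorem 0.1, (2) ⟺ (3).**  For finite groups `G₁, G₂` and a prime `p`,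
the permutation `F_p[Out Q]`-modules `F_p Rep(Q,Gᵢ)` are isomorphic for every finite `p`-group
`Q` iff the permutation modules `F_p Inj(Q,Gᵢ)` are isomorphic for every finite `p`-group `Q`. -/
theorem rep_iso_iff_inj_iso (p : ℕ) (hp : p.Prime)
    (G₁ G₂ : Type) [Group G₁] [Fintype G₁] [Group G₂] [Fintype G₂] :
    (∀ (Q : Type) [Group Q] [Fintype Q], IsPGroup p Q →
      Nonempty (Rep.ofMulAction (ZMod p) (Out Q) (RepCl Q G₁) ≅
        Rep.ofMulAction (ZMod p) (Out Q) (RepCl Q G₂))) ↔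
    (∀ (Q : Type) [Group Q] [Fintype Q], IsPGroup p Q →
      Nonempty (Rep.ofMulAction (ZMod p) (Out Q) (InjCl Q G₁) ≅
        Rep.ofMulAction (ZMod p) (Out Q) (InjCl Q G₂))) := by
  simp_rw [nonempty_rep_iso_iff_permIso]
  have : Fact p.Prime := ⟨hp⟩
  constructor
  · intro h Q _ _ hQ
    induction hn : Nat.card Q using Nat.strong_induction_on generalizing Q with
    | h n ih =>
    have hnon : PermIso (ZMod p) (Out Q) (NonInjCl Q G₁) (NonInjCl Q G₂) := by
      refine permIso_nonInjCl fun K _ hK => ?_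
      let _ := Fintype.ofFinite (Q ⧸ K)
      refine ih _ ?_ (Q ⧸ K) (hQ.to_quotient K) rfl
      have hcard := K.card_eq_card_quotient_mul_card_subgroup
      have h1 : 1 < Nat.card K := (Subgroup.one_lt_card_iff_ne_bot K).2 hK
      rw [← hn, hcard]
      exact lt_mul_of_one_lt_right Nat.card_pos h1
    exact PermIso.of_sum (((permIso_injCl_sum_nonInjCl _).trans (h Q hQ)).trans
      (permIso_injCl_sum_nonInjCl _).symm) hnon
  · intro h Q _ _ hQ
    have hnon : PermIso (ZMod p) (Out Q) (NonInjCl Q G₁) (NonInjCl Q G₂) := by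
      refine permIso_nonInjCl fun K _ _ => ?_
      let _ := Fintype.ofFinite (Q ⧸ K)
      exact h (Q ⧸ K) (hQ.to_quotient K)
    exact ((permIso_injCl_sum_nonInjCl _).symm.trans ((h Q hQ).sum hnon)).trans
      (permIso_injCl_sum_nonInjCl _)
end

section
/- Let p be a prime, G a finite group, and H, K subgroups of G whose orders are prime to p. Then H and K are pointwise conjugate in G if and only if the permutation representations of G over the field F_p = ZMod p on the coset spaces G/H and G/K are isomorphic as representations of G (equivalently, F_p[G/H] ≅ F_p[G/K] as F_p[G]-modules). -/
/-- Two subgroups `H, K ≤ G` are *pointwise conjugate in `G`* if there is a bijection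
`α : H → K` such that every `h ∈ H` is sent to a conjugate `α h = gₕ⁻¹ * h * gₕ` of itself,
for some `gₕ ∈ G` depending on `h`. -/
def PointwiseConj {G : Type*} [Group G] (H K : Subgroup G) : Prop :=
  ∃ α : H ≃ K, ∀ h : H, ∃ g : G, (α h : G) = g⁻¹ * h * g

namespace Matrix

variable {n R S : Type*} [Fintype n] [DecidableEq n] [CommRing R] [CommRing S]

lemma isUnit_of_isUnit_mapMatrix (f : R →+* S) [IsLocalHom f] {M : Matrix n n R}
    (h : IsUnit (f.mapMatrix M)) : IsUnit M := by
  rw [isUnit_iff_isUnit_det] at h ⊢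
  rw [← RingHom.map_det] at h
  exact isUnit_of_map_unit f _ h

lemma trace_eq_of_mul_eq_mul {X Y M : Matrix n n R} (hM : IsUnit M) (h : X * M = M * Y) :
    X.trace = Y.trace := by
  obtain ⟨u, rfl⟩ := hM
  rw [← Matrix.trace_units_conj u Y, ← h, Units.mul_inv_cancel_right]

lemma mapMatrix_surjective {f : R →+* S} (hf : Function.Surjective f) :
    Function.Surjective (f.mapMatrix : Matrix n n R →+* Matrix n n S) := fun A ↦
  ⟨A.map (Function.surjInv hf), by ext; simp [Function.surjInv_eq]⟩

lemma trace_eq_of_pow_eq_one {f : R →+* S} [IsLocalHom f] (hf : Function.Surjective f)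
    {d : ℕ} (hd : IsUnit (d : R)) {X Y : Matrix n n R} (hX : X ^ d = 1) (hY : Y ^ d = 1)
    {a : Matrix n n S} (ha : IsUnit a) (h : f.mapMatrix X * a = a * f.mapMatrix Y) :
    X.trace = Y.trace := by
  obtain ⟨A, rfl⟩ := mapMatrix_surjective hf a
  have hpow (i : ℕ) : f.mapMatrix X ^ i * f.mapMatrix A = f.mapMatrix A * f.mapMatrix Y ^ i := by
    have : SemiconjBy (f.mapMatrix A) (f.mapMatrix Y) (f.mapMatrix X) := h.symm
    exact (this.pow_right i).symm
  rcases Nat.eq_zero_or_pos d with rfl | hpos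
  · have : Subsingleton R := by
      rw [Nat.cast_zero, isUnit_zero_iff] at hd
      exact subsingleton_of_zero_eq_one hd
    exact Subsingleton.elim _ _
  refine trace_eq_of_mul_eq_mul (M := ∑ i ∈ Finset.range d, X ^ i * A * Y ^ (d - i)) ?_ ?_
  · apply isUnit_of_isUnit_mapMatrix f
    have : f.mapMatrix (∑ i ∈ Finset.range d, X ^ i * A * Y ^ (d - i)) =
        (d : Matrix n n S) * f.mapMatrix A := by
      rw [map_sum, Finset.sum_congr rfl (g := fun _ ↦ f.mapMatrix A), Finset.sum_const,
        Finset.card_range, nsmul_eq_mul]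
      intro i hi
      rw [map_mul, map_mul, map_pow, map_pow, hpow, mul_assoc, ← pow_add,
        Nat.add_sub_cancel' (Finset.mem_range.mp hi).le, ← map_pow, hY, map_one, mul_one]
    rw [this]
    refine IsUnit.mul ?_ ha
    simpa using (hd.map f).map (algebraMap S (Matrix n n S))
  · have key := (Finset.sum_range_succ (fun i ↦ X ^ i * A * Y ^ (d + 1 - i)) d).symm.trans
      (Finset.sum_range_succ' (fun i ↦ X ^ i * A * Y ^ (d + 1 - i)) d)
    have h0 : X ^ d * A * Y ^ (d + 1 - d) = X ^ 0 * A * Y ^ (d + 1 - 0) := by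
      simp [hX, hY, pow_succ]
    rw [h0, add_left_inj] at key
    rw [Finset.mul_sum, Finset.sum_mul]
    refine (Finset.sum_congr rfl fun i hi ↦ ?_).trans (key.symm.trans
      (Finset.sum_congr rfl fun i hi ↦ ?_))
    · rw [Nat.add_sub_add_right, pow_succ']
      simp only [mul_assoc]
    · rw [Nat.sub_add_comm (Finset.mem_range.mp hi).le, pow_succ]
      simp only [mul_assoc]

lemma trace_eq_of_isIdempotentElem {f : R →+* S} [IsLocalHom f] (hf : Function.Surjective f)
    {E D : Matrix n n R} (hE : IsIdempotentElem E) (hD : IsIdempotentElem D)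
    {a : Matrix n n S} (ha : IsUnit a) (h : f.mapMatrix E * a = a * f.mapMatrix D) :
    E.trace = D.trace := by
  obtain ⟨A, rfl⟩ := mapMatrix_surjective hf a
  refine trace_eq_of_mul_eq_mul (M := E * A * D + (1 - E) * A * (1 - D)) ?_ ?_
  · apply isUnit_of_isUnit_mapMatrix f
    convert ha using 1
    have hD' : f.mapMatrix D * f.mapMatrix D = f.mapMatrix D := by rw [← map_mul, hD.eq]
    simp only [map_add, map_mul, map_sub, map_one]
    rw [sub_mul, h, one_mul, mul_assoc, hD', sub_mul, mul_sub, mul_sub,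
      mul_assoc _ _ (f.mapMatrix D), hD']
    simp
  · have h1 : E * (1 - E) = 0 := by rw [mul_sub, hE.eq, mul_one, sub_self]
    have h2 : (1 - D) * D = 0 := by rw [sub_mul, hD.eq, one_mul, sub_self]
    have e1 : E * (E * A * D) = E * A * D := by rw [mul_assoc, ← mul_assoc, hE.eq]
    have e2 : E * ((1 - E) * A * (1 - D)) = 0 := by
      rw [mul_assoc, ← mul_assoc, h1, zero_mul]
    have e3 : E * A * D * D = E * A * D := by rw [mul_assoc, hD.eq]
    have e4 : (1 - E) * A * (1 - D) * D = 0 := by rw [mul_assoc, h2, mul_zero]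
    rw [mul_add, add_mul, e1, e2, e3, e4]

lemma exists_diagonal_conj {F : Type*} [Field F] {e : Matrix n n F} (he : IsIdempotentElem e) :
    ∃ (s : Finset n) (a : Matrix n n F), IsUnit a ∧
      e * a = a * diagonal (fun i ↦ if i ∈ s then 1 else 0) ∧
      s.card = Module.finrank F (LinearMap.range (toLin' e)) := by
  have hp : IsIdempotentElem (toLin' e) := by
    rw [IsIdempotentElem, Module.End.mul_eq_comp, ← toLin'_mul, he.eq]
  let b := ((Module.finBasis F (LinearMap.range (toLin' e))).prod
    (Module.finBasis F (LinearMap.ker (toLin' e)))).map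
      (Submodule.prodEquivOfIsCompl _ _ (LinearMap.IsIdempotentElem.isCompl hp))
  obtain ⟨σ⟩ : Nonempty (Fin (Module.finrank F (LinearMap.range (toLin' e))) ⊕
      Fin (Module.finrank F (LinearMap.ker (toLin' e))) ≃ n) := by
    rw [← Fintype.card_eq, ← Module.finrank_eq_card_basis b, Module.finrank_fintype_fun_eq_card]
  refine ⟨Finset.univ.image fun i ↦ σ (Sum.inl i), (Pi.basisFun F n).toMatrix (b.reindex σ),
    ?_, ?_, ?_⟩
  · have := (Pi.basisFun F n).invertibleToMatrix (b.reindex σ)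
    exact isUnit_of_invertible _
  · have hcol (k : n) : e *ᵥ (b.reindex σ k) =
        (if k ∈ Finset.univ.image fun i ↦ σ (Sum.inl i) then (1 : F) else 0) • b.reindex σ k := by
      obtain ⟨k, rfl⟩ := σ.surjective k
      rcases k with k | k
      · have hk := (LinearMap.IsIdempotentElem.mem_range_iff hp).mp
          (Module.finBasis F (LinearMap.range (toLin' e)) k).2
        simpa [b] using hk
      · have hk := (Module.finBasis F (LinearMap.ker (toLin' e)) k).2
        rw [LinearMap.mem_ker, toLin'_apply] at hk
        simp [b, hk]
    ext i k
    rw [mul_diagonal]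
    have := congrFun (hcol k) i
    rw [Pi.smul_apply, smul_eq_mul, mul_comm] at this
    rw [Module.Basis.toMatrix_apply, Pi.basisFun_repr, ← this]
    simp [mul_apply, mulVec, dotProduct, Module.Basis.toMatrix_apply]
  · rw [Finset.card_image_of_injective _ fun _ _ h ↦ Sum.inl_injective (σ.injective h)]
    simp

lemma trace_eq_finrank_range {F : Type*} [Field F] {f : R →+* F} [IsLocalHom f]
    (hf : Function.Surjective f) {E : Matrix n n R} (hE : IsIdempotentElem E) :
    E.trace = (Module.finrank F (LinearMap.range (toLin' (f.mapMatrix E))) : R) := by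
  obtain ⟨s, a, ha, h, hs⟩ := exists_diagonal_conj (hE.map f.mapMatrix)
  rw [← hs, trace_eq_of_isIdempotentElem hf hE
    (D := diagonal (fun i ↦ if i ∈ s then 1 else 0)) _ ha]
  · simp [trace_diagonal]
  · rw [h]; congr 1; ext i j; simp [diagonal_apply, apply_ite f]
  · rw [IsIdempotentElem, diagonal_mul_diagonal]; congr 1; ext i; split_ifs <;> simp

end Matrix

lemma ZMod.isLocalHom_castHom_pow (p k : ℕ) [Fact p.Prime] (hk : k ≠ 0) :
    IsLocalHom (ZMod.castHom (dvd_pow_self p hk) (ZMod p)) where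
  map_nonunit x hx := by
    have : NeZero (p ^ k) := ⟨pow_ne_zero _ (Fact.out : p.Prime).ne_zero⟩
    obtain ⟨m, rfl⟩ := ZMod.natCast_zmod_surjective x
    rw [map_natCast, ZMod.isUnit_iff_coprime] at hx
    rw [ZMod.isUnit_iff_coprime]
    exact hx.pow_right k

lemma one_add_natCast_mul_pow_eq_one {A : Type*} [Ring A] (p k : ℕ) (y : A)
    (hp : ((p ^ k : ℕ) : A) = 0) :
    (1 + p * y) ^ p ^ k = 1 := by
  have h := dvd_sub_pow_of_dvd_sub (R := Polynomial ℤ) (p := p)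
    (a := 1 + (p : Polynomial ℤ) * Polynomial.X)
    (b := 1) (by simp) k
  obtain ⟨q, hq⟩ := h
  have := congrArg (Polynomial.aeval y) hq
  simp only [one_pow, map_sub, map_pow, map_add, map_mul, map_one, map_natCast,
    Polynomial.aeval_X] at this
  rw [← sub_eq_zero, this, pow_succ, ← Nat.cast_pow, hp, zero_mul, zero_mul]

lemma MonoidHom.exists_rightInverse_of_isPGroup_ker {Γ L : Type*} [Group Γ] [Group L] [Finite Γ]
    {p : ℕ} [Fact p.Prime] (π : Γ →* L) (hπ : Function.Surjective π) (hker : IsPGroup p π.ker)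
    (hL : (Nat.card L).Coprime p) : ∃ s : L →* Γ, ∀ l, π (s l) = l := by
  obtain ⟨m, hm⟩ := hker.exists_card_eq
  have hidx : π.ker.index = Nat.card L := by
    rw [Subgroup.index_ker, MonoidHom.range_eq_top.mpr hπ, Subgroup.card_top]
  obtain ⟨C, hC⟩ := Subgroup.exists_right_complement'_of_coprime (N := π.ker)
    (by rw [hm, hidx]; exact (hL.pow_right m).symm)
  have hinj : Function.Injective (π.comp C.subtype) := by
    rw [injective_iff_map_eq_one]
    intro c hc
    have := Subgroup.disjoint_def.mp hC.disjoint (MonoidHom.mem_ker.mpr hc) c.2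
    exact Subtype.ext this
  have hbij : Function.Bijective (π.comp C.subtype) := by
    have := Finite.of_surjective π hπ
    refine (Nat.bijective_iff_injective_and_card _).mpr ⟨hinj, ?_⟩
    rw [← hidx, hC.symm.index_eq_card]
  let e := MulEquiv.ofBijective _ hbij
  exact ⟨C.subtype.comp e.symm.toMonoidHom, fun l ↦ e.apply_symm_apply l⟩

lemma Matrix.exists_lift_of_coprime {n L : Type*} [Fintype n] [DecidableEq n] [Group L] [Finite L]
    (p k : ℕ) [Fact p.Prime] (hk : k ≠ 0) (hL : (Nat.card L).Coprime p)
    (ρ : L →* Matrix n n (ZMod p)) :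
    ∃ φ : L →* Matrix n n (ZMod (p ^ k)),
      ∀ l, (ZMod.castHom (dvd_pow_self p hk) (ZMod p)).mapMatrix (φ l) = ρ l := by
  have := ZMod.isLocalHom_castHom_pow p k hk
  have : NeZero (p ^ k) := ⟨pow_ne_zero _ (Fact.out : p.Prime).ne_zero⟩
  set f := ZMod.castHom (dvd_pow_self p hk) (ZMod p)
  let Γ : Subgroup ((Matrix n n (ZMod (p ^ k)))ˣ × L) :=
    ((Units.map f.mapMatrix.toMonoidHom).comp (MonoidHom.fst _ _)).eqLocus
      (ρ.toHomUnits.comp (MonoidHom.snd _ _))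
  have hΓ (x : Γ) : f.mapMatrix (x.1.1 : Matrix n n (ZMod (p ^ k))) = ρ x.1.2 :=
    congrArg Units.val x.2
  let π : Γ →* L := (MonoidHom.snd _ _).comp Γ.subtype
  have hπ : Function.Surjective π := by
    intro l
    obtain ⟨A, hA⟩ := mapMatrix_surjective (ZMod.castHom_surjective _) (ρ l)
    have hu : IsUnit A := isUnit_of_isUnit_mapMatrix f (by
      rw [hA]; exact (Group.isUnit l).map ρ)
    exact ⟨⟨(hu.unit, l), Units.ext hA⟩, rfl⟩
  have hker : IsPGroup p π.ker := by
    rintro ⟨x, hx⟩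
    refine ⟨k, Subtype.ext (Subtype.ext (Prod.ext (Units.ext ?_) ?_))⟩
    · have h1 : f.mapMatrix (x.1.1 : Matrix n n (ZMod (p ^ k))) = 1 := by
        rw [hΓ, show x.1.2 = 1 from hx, map_one]
      have h2 (i j : n) : ∃ y, ((x.1.1 : Matrix n n (ZMod (p ^ k))) - 1) i j = p * y := by
        have h3 : f (((x.1.1 : Matrix n n (ZMod (p ^ k))) - 1) i j) = 0 := by
          have : f.mapMatrix ((x.1.1 : Matrix n n (ZMod (p ^ k))) - 1) = 0 := by
            rw [map_sub, h1, map_one, sub_self]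
          exact congrFun (congrFun this i) j
        obtain ⟨m, hm⟩ := ZMod.natCast_zmod_surjective
          (((x.1.1 : Matrix n n (ZMod (p ^ k))) - 1) i j)
        rw [← hm, map_natCast, ZMod.natCast_eq_zero_iff] at h3
        obtain ⟨c, rfl⟩ := h3
        exact ⟨c, by rw [← hm, Nat.cast_mul]⟩
      choose Y hY using h2
      have h4 : (x.1.1 : Matrix n n (ZMod (p ^ k))) = 1 + p * (Matrix.of Y) := by
        rw [← sub_eq_iff_eq_add']
        ext i j
        rw [hY, ← nsmul_eq_mul p (Matrix.of Y), smul_apply, nsmul_eq_mul, of_apply]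
      have h5 : ((p ^ k : ℕ) : Matrix n n (ZMod (p ^ k))) = 0 := by
        rw [← map_natCast (algebraMap (ZMod (p ^ k)) _), ZMod.natCast_self, map_zero]
      have := one_add_natCast_mul_pow_eq_one p k (Matrix.of Y) h5
      rw [← h4] at this
      simpa using this
    · have : x.1.2 = 1 := hx
      simp [this]
  obtain ⟨s, hs⟩ := π.exists_rightInverse_of_isPGroup_ker hπ hker hL
  refine ⟨(Units.coeHom _).comp ((MonoidHom.fst _ _).comp (Γ.subtype.comp s)), fun l ↦ ?_⟩
  refine (hΓ (s l)).trans (congrArg ρ (hs l))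

open Matrix in
lemma Matrix.sum_trace_eq_card_mul_finrank {n L V : Type*} [Fintype n] [DecidableEq n] [Group L]
    [Fintype L] {R F : Type*} [CommRing R] [Field F] [AddCommGroup V] [Module F V]
    {f : R →+* F} [IsLocalHom f] (hf : Function.Surjective f) (hL : IsUnit (Nat.card L : R))
    (φ : L →* Matrix n n R) (ρ : Representation F L V) (b : Module.Basis n F V)
    (h : ∀ l, f.mapMatrix (φ l) = LinearMap.toMatrix b b (ρ l)) :
    ∑ l, (φ l).trace = Nat.card L * (Module.finrank F ρ.invariants : R) := by
  obtain ⟨u, hu⟩ := hL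
  let E : Matrix n n R := (↑u⁻¹ : R) • ∑ l, φ l
  have hφE (l : L) : φ l * E = E := by
    rw [mul_smul_comm, Finset.mul_sum]
    congr 1
    simp_rw [← map_mul]
    exact Equiv.sum_comp (Equiv.mulLeft l) fun x ↦ φ x
  have hE : IsIdempotentElem E := by
    calc E * E = (↑u⁻¹ : R) • ∑ l, φ l * E := by rw [smul_mul_assoc, Finset.sum_mul]
      _ = (↑u⁻¹ : R) • (Nat.card L : R) • E := by
          simp_rw [hφE]
          rw [Finset.sum_const, Finset.card_univ, Nat.card_eq_fintype_card, Nat.cast_smul_eq_nsmul]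
      _ = E := by rw [← hu, smul_smul, Units.inv_mul, one_smul]
  have hrepr (l : L) (v : V) : f.mapMatrix (φ l) *ᵥ b.equivFun v = b.equivFun (ρ l v) := by
    rw [h]
    exact LinearMap.toMatrix_mulVec_repr b b (ρ l) v
  have hrange : LinearMap.range (toLin' (f.mapMatrix E)) =
      ρ.invariants.map (b.equivFun : V →ₗ[F] n → F) := by
    ext v
    constructor
    · rintro ⟨w, rfl⟩
      refine ⟨b.equivFun.symm (toLin' (f.mapMatrix E) w), fun l ↦ ?_,
        b.equivFun.apply_symm_apply _⟩
      apply b.equivFun.injective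
      rw [← hrepr, LinearEquiv.apply_symm_apply, toLin'_apply, mulVec_mulVec, ← map_mul, hφE]
    · rintro ⟨w, hw, rfl⟩
      refine ⟨b.equivFun w, ?_⟩
      have hsum : f.mapMatrix E = f (↑u⁻¹ : R) • ∑ l, f.mapMatrix (φ l) := by
        rw [← map_sum]
        ext i j
        simp [E, Matrix.sum_apply]
      rw [toLin'_apply, hsum, smul_mulVec, sum_mulVec]
      simp_rw [hrepr, hw _]
      rw [Finset.sum_const, Finset.card_univ, ← Nat.card_eq_fintype_card,
        ← Nat.cast_smul_eq_nsmul F, smul_smul, ← map_natCast f, ← hu, ← map_mul, Units.inv_mul,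
        map_one, one_smul]
      rfl
  have htr := trace_eq_finrank_range hf hE
  rw [hrange, LinearEquiv.finrank_map_eq] at htr
  rw [← htr, trace_smul, trace_sum, smul_eq_mul, ← mul_assoc, ← hu, Units.mul_inv, one_mul]

lemma PointwiseConj.finrank_invariants_eq {p : ℕ} [Fact p.Prime] {G V : Type*} [Group G] [Finite G]
    {H K : Subgroup G} (hHK : PointwiseConj H K) (hH : (Nat.card H).Coprime p)
    [AddCommGroup V] [Module (ZMod p) V] [FiniteDimensional (ZMod p) V]
    (ρ : Representation (ZMod p) G V) :
    Module.finrank (ZMod p) (Representation.invariants (MonoidHom.comp ρ H.subtype)) =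
      Module.finrank (ZMod p) (Representation.invariants (MonoidHom.comp ρ K.subtype)) := by
  obtain ⟨α, hα⟩ := hHK
  have hcard : Nat.card H = Nat.card K := Nat.card_congr α
  have := Fintype.ofFinite H
  have := Fintype.ofFinite K
  set d := Module.finrank (ZMod p) V with hd
  let b := Module.finBasis (ZMod p) V
  have hk : d + 1 ≠ 0 := d.succ_ne_zero
  have := ZMod.isLocalHom_castHom_pow p (d + 1) hk
  have hf : Function.Surjective (ZMod.castHom (dvd_pow_self p hk) (ZMod p)) :=
    ZMod.castHom_surjective _
  set f := ZMod.castHom (dvd_pow_self p hk) (ZMod p)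
  let τ : G →* Matrix (Fin d) (Fin d) (ZMod p) :=
    (LinearMap.toMatrixAlgEquiv b : _ →* Matrix (Fin d) (Fin d) (ZMod p)).comp ρ
  obtain ⟨φ, hφ⟩ := Matrix.exists_lift_of_coprime p (d + 1) hk hH (τ.comp H.subtype)
  obtain ⟨ψ, hψ⟩ := Matrix.exists_lift_of_coprime p (d + 1) hk (hcard ▸ hH) (τ.comp K.subtype)
  have hunit : IsUnit (Nat.card H : ZMod (p ^ (d + 1))) := by
    rw [ZMod.isUnit_iff_coprime]
    exact hH.pow_right _
  have h1 := Matrix.sum_trace_eq_card_mul_finrank hf hunit φ (MonoidHom.comp ρ H.subtype) b hφ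
  have h2 := Matrix.sum_trace_eq_card_mul_finrank hf (hcard ▸ hunit) ψ
    (MonoidHom.comp ρ K.subtype) b hψ
  have htr (x : H) : (φ x).trace = (ψ (α x)).trace := by
    obtain ⟨g, hg⟩ := hα x
    refine Matrix.trace_eq_of_pow_eq_one hf hunit (X := φ x) (Y := ψ (α x)) (a := τ g)
      ?_ ?_ ((Group.isUnit g).map τ) ?_
    · rw [← map_pow, pow_card_eq_one', map_one]
    · rw [← map_pow, hcard, pow_card_eq_one', map_one]
    · rw [show f.mapMatrix (φ x) = τ x from hφ x, show f.mapMatrix (ψ (α x)) = τ (α x) from hψ _,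
        hg, ← map_mul, ← map_mul]
      congr 1
      group
  have h3 : ∑ x, (φ x).trace = ∑ y, (ψ y).trace :=
    (Finset.sum_congr rfl fun x _ ↦ htr x).trans (α.sum_comp fun y ↦ (ψ y).trace)
  rw [h1, h2, ← hcard] at h3
  have h4 := hunit.mul_left_cancel h3
  have hlt (W : Submodule (ZMod p) V) : Module.finrank (ZMod p) W < p ^ (d + 1) :=
    (Submodule.finrank_le W).trans_lt ((Nat.lt_succ_self d).trans
      (Nat.lt_pow_self (Fact.out : p.Prime).one_lt))
  rw [ZMod.natCast_eq_natCast_iff] at h4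
  exact Nat.ModEq.eq_of_lt_of_lt h4 (hlt _) (hlt _)

open Finset in
lemma Finset.card_filter_eq_of_card_filter_le {X P : Type*} [PartialOrder P] [Finite P] (s : X → P)
    (A B : Finset X) [DecidableEq P] [DecidableLE P]
    (h : ∀ N, #{x ∈ A | s x ≤ N} = #{x ∈ B | s x ≤ N}) (N : P) :
    #{x ∈ A | s x = N} = #{x ∈ B | s x = N} := by
  have := Fintype.ofFinite P
  induction N using (wellFounded_lt (α := P)).induction with
  | _ N ih =>
    have hsum (C : Finset X) : #{x ∈ C | s x ≤ N} =
        ∑ M ∈ Finset.univ.filter (· ≤ N), #{x ∈ C | s x = M} := by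
      rw [Finset.card_eq_sum_card_fiberwise (f := s) (t := Finset.univ.filter (· ≤ N))]
      · refine Finset.sum_congr rfl fun M hM ↦ ?_
        congr 1
        ext x
        simp only [Finset.mem_filter, Finset.mem_univ, true_and] at hM ⊢
        exact ⟨fun hx ↦ ⟨hx.1.1, hx.2⟩, fun hx ↦ ⟨⟨hx.1, hx.2.le.trans hM⟩, hx.2⟩⟩
      · intro x hx
        simpa using (Finset.mem_filter.mp hx).2
    have hN : N ∈ Finset.univ.filter (· ≤ N) := by simp
    have key := h N
    rw [hsum, hsum, ← Finset.add_sum_erase _ _ hN, ← Finset.add_sum_erase _ _ hN,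
      Finset.sum_congr rfl fun M hM ↦ ih M ?_] at key
    · exact Nat.add_right_cancel key
    · rw [Finset.mem_erase, Finset.mem_filter] at hM
      exact lt_of_le_of_ne hM.2.2 hM.1

namespace Representation

variable {k G V : Type*} [CommRing k] [Group G] [AddCommGroup V] [Module k V]

/-- The subrepresentation generated by a vector. -/
def generatedBy (ρ : Representation k G V) (v : V) : Subrepresentation ρ where
  toSubmodule := Submodule.span k (Set.range fun g ↦ ρ g v)
  apply_mem_toSubmodule g w hw := by
    induction hw using Submodule.span_induction with
    | mem x hx =>
      obtain ⟨g', rfl⟩ := hx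
      exact Submodule.subset_span ⟨g * g', by simp⟩
    | zero => simp
    | add x y _ _ hx hy => rw [map_add]; exact add_mem hx hy
    | smul a x _ hx => rw [map_smul]; exact Submodule.smul_mem _ a hx

lemma generatedBy_le_iff (ρ : Representation k G V) (v : V) (N : Subrepresentation ρ) :
    ρ.generatedBy v ≤ N ↔ v ∈ N.toSubmodule := by
  change Submodule.span k (Set.range fun g ↦ ρ g v) ≤ N.toSubmodule ↔ _
  rw [Submodule.span_le]
  constructor
  · intro h
    simpa using h ⟨1, rfl⟩
  · rintro h _ ⟨g, rfl⟩
    exact N.apply_mem_toSubmodule g h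

end Representation

open Classical Finset in
lemma PointwiseConj.exists_generatedBy_eq_top {p : ℕ} [Fact p.Prime] {G V : Type*} [Group G]
    [Finite G] {H K : Subgroup G} (hHK : PointwiseConj H K) (hH : (Nat.card H).Coprime p)
    [AddCommGroup V] [Module (ZMod p) V] [FiniteDimensional (ZMod p) V]
    (ρ : Representation (ZMod p) G V) {w : V} (hw : ∀ g ∈ K, ρ g w = w)
    (hgen : ρ.generatedBy w = ⊤) :
    ∃ v : V, (∀ g ∈ H, ρ g v = v) ∧ ρ.generatedBy v = ⊤ := by
  have : Finite V := Module.finite_of_finite (ZMod p)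
  have := Fintype.ofFinite V
  have : Finite (Subrepresentation ρ) :=
    Finite.of_injective _ Subrepresentation.toSubmodule_injective
  have hcard (L : Subgroup G) (N : Subrepresentation ρ) :
      #{v ∈ Finset.univ.filter (fun v ↦ ∀ g ∈ L, ρ g v = v) | ρ.generatedBy v ≤ N} =
        p ^ Module.finrank (ZMod p)
          (Representation.invariants (MonoidHom.comp N.toRepresentation L.subtype)) := by
    have h1 := Module.natCard_eq_pow_finrank (K := ZMod p)
      (V := Representation.invariants (MonoidHom.comp N.toRepresentation L.subtype))
    rw [Nat.card_zmod] at h1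
    rw [← h1, Finset.filter_filter, ← Fintype.card_subtype, ← Nat.card_eq_fintype_card]
    exact Nat.card_congr
      { toFun v := ⟨⟨v.1, (ρ.generatedBy_le_iff v N).mp v.2.2⟩,
          fun g ↦ Subtype.ext (v.2.1 g g.2)⟩
        invFun w := ⟨w.1.1, fun g hg ↦ congrArg Subtype.val (w.2 ⟨g, hg⟩),
          (ρ.generatedBy_le_iff w N).mpr w.1.2⟩
        left_inv _ := rfl
        right_inv _ := rfl }
  have key := Finset.card_filter_eq_of_card_filter_le ρ.generatedBy
    (Finset.univ.filter fun v ↦ ∀ g ∈ H, ρ g v = v)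
    (Finset.univ.filter fun v ↦ ∀ g ∈ K, ρ g v = v)
    (fun N ↦ by
      rw [hcard, hcard, hHK.finrank_invariants_eq hH]) ⊤
  have hpos : 0 < #{v ∈ Finset.univ.filter (fun v ↦ ∀ g ∈ K, ρ g v = v) | ρ.generatedBy v = ⊤} :=
    Finset.card_pos.mpr ⟨w, by simp [hgen]; exact hw⟩
  rw [← key] at hpos
  obtain ⟨v, hv⟩ := Finset.card_pos.mp hpos
  simp only [Finset.mem_filter, Finset.mem_univ, true_and] at hv
  exact ⟨v, hv⟩

open MonoidAlgebra in
lemma PointwiseConj.nonempty_equiv_ofMulAction {p : ℕ} [Fact p.Prime] {G : Type*} [Group G]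
    [Finite G] {H K : Subgroup G} (hHK : PointwiseConj H K) (hH : (Nat.card H).Coprime p) :
    Nonempty ((Representation.ofMulAction (ZMod p) G (G ⧸ H)).Equiv
      (Representation.ofMulAction (ZMod p) G (G ⧸ K))) := by
  set σ := Representation.ofMulAction (ZMod p) G (G ⧸ K)
  have := Fintype.ofFinite (G ⧸ H)
  have := Fintype.ofFinite (G ⧸ K)
  let bH : Module.Basis (G ⧸ H) (ZMod p) (MonoidAlgebra (ZMod p) (G ⧸ H)) :=
    .ofRepr (coeffLinearEquiv (ZMod p))
  let bK : Module.Basis (G ⧸ K) (ZMod p) (MonoidAlgebra (ZMod p) (G ⧸ K)) :=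
    .ofRepr (coeffLinearEquiv (ZMod p))
  have hbH (x : G ⧸ H) : bH x = single x 1 := rfl
  have hbK (x : G ⧸ K) : bK x = single x 1 := rfl
  have := Module.Finite.of_basis bH
  have := Module.Finite.of_basis bK
  obtain ⟨v, hv, hgen⟩ := hHK.exists_generatedBy_eq_top hH σ (w := bK ((1 : G) : G ⧸ K))
    (by
      intro g hg
      rw [hbK, Representation.ofMulAction_single]
      congr 1
      rw [MulAction.Quotient.smul_coe, QuotientGroup.eq]
      simpa using hg)
    (by
      rw [← top_le_iff]
      change ⊤ ≤ Submodule.span _ _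
      rw [← bK.span_eq]
      refine Submodule.span_mono ?_
      rintro _ ⟨x, rfl⟩
      obtain ⟨g, rfl⟩ := QuotientGroup.mk_surjective x
      refine ⟨g, ?_⟩
      simp only [hbK, Representation.ofMulAction_single, σ]
      congr 1
      simp)
  let f : MonoidAlgebra (ZMod p) (G ⧸ H) →ₗ[ZMod p] MonoidAlgebra (ZMod p) (G ⧸ K) :=
    bH.constr (ZMod p) fun x ↦ σ x.out v
  have hf (g : G) : f (single ((g : G) : G ⧸ H) 1) = σ g v := by
    rw [← hbH, Module.Basis.constr_basis]
    obtain ⟨h, hh⟩ := QuotientGroup.mk_out_eq_mul H g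
    rw [hh, map_mul, Module.End.mul_apply, hv _ h.2]
  have hsurj : Function.Surjective f := by
    rw [← LinearMap.range_eq_top, ← top_le_iff]
    have h1 : Submodule.span (ZMod p) (Set.range fun g ↦ σ g v) = ⊤ :=
      congrArg Subrepresentation.toSubmodule hgen
    rw [← h1, Submodule.span_le]
    rintro _ ⟨g, rfl⟩
    exact ⟨_, hf g⟩
  have hcard : Nat.card H = Nat.card K := Nat.card_congr hHK.choose
  have hfin : Module.finrank (ZMod p) (MonoidAlgebra (ZMod p) (G ⧸ H)) =
      Module.finrank (ZMod p) (MonoidAlgebra (ZMod p) (G ⧸ K)) := by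
    rw [Module.finrank_eq_card_basis bH, Module.finrank_eq_card_basis bK,
      ← Nat.card_eq_fintype_card, ← Nat.card_eq_fintype_card]
    refine Nat.eq_of_mul_eq_mul_right (Nat.card_pos (α := H)) ?_
    rw [← Subgroup.card_eq_card_quotient_mul_card_subgroup, hcard,
      ← Subgroup.card_eq_card_quotient_mul_card_subgroup]
  have hinj : Function.Injective f :=
    (LinearMap.injective_iff_surjective_of_finrank_eq_finrank hfin).mpr hsurj
  refine ⟨.mk (LinearEquiv.ofBijective f ⟨hinj, hsurj⟩) fun g ↦ bH.ext fun x ↦ ?_⟩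
  obtain ⟨x, rfl⟩ := QuotientGroup.mk_surjective x
  change f (_) = σ g (f _)
  rw [hbH, hf, Representation.ofMulAction_single, MulAction.Quotient.smul_coe, hf, smul_eq_mul,
    map_mul, Module.End.mul_apply]

lemma Matrix.permMatrix_apply {n R : Type*} [DecidableEq n] [Zero R] [One R] (σ : Equiv.Perm n)
    (i j : n) : σ.permMatrix R i j = if σ i = j then 1 else 0 := by
  simp [Equiv.Perm.permMatrix, PEquiv.toMatrix, eq_comm]

lemma Equiv.Perm.ncard_fixedPoints_eq_of_conj {n : Type*} [Fintype n] [DecidableEq n] {p d : ℕ}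
    [Fact p.Prime] (hd : d.Coprime p) {σ τ : Equiv.Perm n} (hσ : σ ^ d = 1) (hτ : τ ^ d = 1)
    {a : Matrix n n (ZMod p)} (ha : IsUnit a)
    (h : σ.permMatrix (ZMod p) * a = a * τ.permMatrix (ZMod p)) :
    (Function.fixedPoints σ).ncard = (Function.fixedPoints τ).ncard := by
  set c := Fintype.card n with hc
  have hk : c + 1 ≠ 0 := c.succ_ne_zero
  have := ZMod.isLocalHom_castHom_pow p (c + 1) hk
  have hunit : IsUnit (d : ZMod (p ^ (c + 1))) := by
    rw [ZMod.isUnit_iff_coprime]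
    exact hd.pow_right _
  have hpow (π : Equiv.Perm n) (hπ : π ^ d = 1) :
      π.permMatrix (ZMod (p ^ (c + 1))) ^ d = 1 := by
    have h1 := map_pow (Matrix.permMatrixHom (n := n) (R := ZMod (p ^ (c + 1)))) π⁻¹ d
    rw [inv_pow, hπ, inv_one, map_one] at h1
    have h2 : Matrix.permMatrixHom (R := ZMod (p ^ (c + 1))) π⁻¹ = π.permMatrix _ := by
      change (π⁻¹)⁻¹.permMatrix _ = _
      rw [inv_inv]
    rw [← h2, ← h1]
  have hmap (π : Equiv.Perm n) : (ZMod.castHom (dvd_pow_self p hk) (ZMod p)).mapMatrix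
      (π.permMatrix (ZMod (p ^ (c + 1)))) = π.permMatrix (ZMod p) := by
    ext i j
    rw [RingHom.mapMatrix_apply, Matrix.map_apply, Matrix.permMatrix_apply, Matrix.permMatrix_apply]
    split_ifs <;> simp
  have htr := Matrix.trace_eq_of_pow_eq_one
    (ZMod.castHom_surjective (dvd_pow_self p hk)) hunit (hpow σ hσ) (hpow τ hτ) ha
    (by rw [hmap, hmap, h])
  rw [Matrix.trace_permutation, Matrix.trace_permutation, ZMod.natCast_eq_natCast_iff] at htr
  have hlt (s : Set n) : s.ncard < p ^ (c + 1) :=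
    ((Set.ncard_le_card s).trans_lt
      (by rw [Nat.card_eq_fintype_card]; exact Nat.lt_succ_self c)).trans
      (Nat.lt_pow_self (Fact.out : p.Prime).one_lt)
  exact htr.eq_of_lt_of_lt (hlt _) (hlt _)

open MonoidAlgebra in
lemma Representation.Equiv.ncard_fixedBy_eq {p d : ℕ} [Fact p.Prime] {G X Y : Type*} [Group G]
    [MulAction G X] [MulAction G Y] [Finite X] [Finite Y]
    (e : (Representation.ofMulAction (ZMod p) G X).Equiv (Representation.ofMulAction (ZMod p) G Y))
    (hd : d.Coprime p) {g : G} (hg : g ^ d = 1) :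
    (MulAction.fixedBy X g).ncard = (MulAction.fixedBy Y g).ncard := by
  classical
  have := Fintype.ofFinite X
  have := Fintype.ofFinite Y
  let bX : Module.Basis X (ZMod p) (MonoidAlgebra (ZMod p) X) := .ofRepr (coeffLinearEquiv (ZMod p))
  let bY : Module.Basis Y (ZMod p) (MonoidAlgebra (ZMod p) Y) := .ofRepr (coeffLinearEquiv (ZMod p))
  let ε : X ≃ Y := bX.indexEquiv (bY.map e.toLinearEquiv.symm)
  let bY' := bY.reindex ε.symm
  let σ : Equiv.Perm X := MulAction.toPerm g⁻¹
  let τ : Equiv.Perm X := ε.symm.permCongr (MulAction.toPerm g⁻¹)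
  have hσm : LinearMap.toMatrix bX bX (Representation.ofMulAction (ZMod p) G X g) =
      σ.permMatrix (ZMod p) := by
    ext i j
    rw [LinearMap.toMatrix_apply]
    change (Representation.ofMulAction (ZMod p) G X g (single j 1)).coeff i = _
    rw [coeff_ofMulAction, Matrix.permMatrix_apply]
    simp [σ, Finsupp.single_apply, eq_comm]
  have hτm : LinearMap.toMatrix bY' bY' (Representation.ofMulAction (ZMod p) G Y g) =
      τ.permMatrix (ZMod p) := by
    ext i j
    rw [LinearMap.toMatrix_apply]
    simp only [bY', Module.Basis.reindex_apply, Module.Basis.repr_reindex_apply, Equiv.symm_symm]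
    change (Representation.ofMulAction (ZMod p) G Y g (single (ε j) 1)).coeff (ε i) = _
    rw [coeff_ofMulAction, Matrix.permMatrix_apply]
    have h1 : τ i = j ↔ ε j = g⁻¹ • ε i := by
      change ε.symm (g⁻¹ • ε i) = j ↔ _
      rw [Equiv.symm_apply_eq, eq_comm]
    simp [h1, Finsupp.single_apply]
  have hσd : σ ^ d = 1 := by
    change (MulAction.toPermHom G X g⁻¹) ^ d = 1
    rw [← map_pow, inv_pow, hg, inv_one, map_one]
  have hτd : τ ^ d = 1 := by
    change (ε.symm.permCongrHom (MulAction.toPermHom G Y g⁻¹)) ^ d = 1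
    rw [← map_pow, ← map_pow, inv_pow, hg, inv_one, map_one, map_one]
  have key := Equiv.Perm.ncard_fixedPoints_eq_of_conj hd hσd hτd
    (a := LinearMap.toMatrix bY' bX e.toLinearEquiv.symm)
    ?_ ?_
  · have h1 : Function.fixedPoints σ = MulAction.fixedBy X g := by
      ext x
      change g⁻¹ • x = x ↔ g • x = x
      rw [inv_smul_eq_iff, eq_comm]
    have h2 : Function.fixedPoints τ = ε ⁻¹' MulAction.fixedBy Y g := by
      ext x
      change ε.symm (g⁻¹ • ε x) = x ↔ g • ε x = ε x
      rw [Equiv.symm_apply_eq, inv_smul_eq_iff, eq_comm]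
    rw [h1, h2, Set.ncard_preimage_of_injective_subset_range ε.injective (by simp)] at key
    exact key
  · refine IsUnit.of_mul_eq_one (LinearMap.toMatrix bX bY' e.toLinearEquiv) ?_
    rw [← LinearMap.toMatrix_comp]
    convert LinearMap.toMatrix_id bX
    exact LinearMap.ext fun v ↦ e.toLinearEquiv.symm_apply_apply v
  · rw [← hσm, ← hτm, ← LinearMap.toMatrix_comp, ← LinearMap.toMatrix_comp]
    congr 1
    exact LinearMap.ext fun v ↦ (e.symm.toIntertwiningMap.isIntertwining _ _ g v).symm

namespace Subgroup

variable {G : Type*} [Group G] (H : Subgroup G) (g : G)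

lemma ncard_fixedBy_quotient_mul_card :
    (MulAction.fixedBy (G ⧸ H) g).ncard * Nat.card H = Nat.card {x : G // x⁻¹ * g * x ∈ H} := by
  rw [← Nat.card_coe_set_eq, mul_comm, ← Nat.card_prod]
  refine Nat.card_congr ((QuotientGroup.preimageMkEquivSubgroupProdSet H _).symm.trans
    (Equiv.subtypeEquivRight fun x ↦ ?_))
  rw [Set.mem_preimage, MulAction.mem_fixedBy, MulAction.Quotient.smul_coe, eq_comm,
    QuotientGroup.eq, smul_eq_mul, mul_assoc]

lemma card_conj_mem :
    Nat.card {x : G // x⁻¹ * g * x ∈ H} =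
      Nat.card {h : H // ConjClasses.mk (h : G) = ConjClasses.mk g} *
        Nat.card {z : G // z⁻¹ * g * z = g} := by
  have hc (h : {h : H // ConjClasses.mk (h : G) = ConjClasses.mk g}) :
      ∃ c : G, c⁻¹ * g * c = h.1 := by
    obtain ⟨c, hc⟩ := isConj_iff.mp (ConjClasses.mk_eq_mk_iff_isConj.mp h.2)
    refine ⟨c, ?_⟩
    calc c⁻¹ * g * c = c⁻¹ * (c * h.1 * c⁻¹) * c := by rw [hc]
      _ = h.1 := by group
  choose c hc using hc
  rw [← Nat.card_prod]
  let r (x : {x : G // x⁻¹ * g * x ∈ H}) :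
      {h : H // ConjClasses.mk (h : G) = ConjClasses.mk g} :=
    ⟨⟨x.1⁻¹ * g * x.1, x.2⟩, ConjClasses.mk_eq_mk_iff_isConj.mpr
      (isConj_iff.mpr ⟨x.1, by group⟩)⟩
  have hz (h) (z : {z : G // z⁻¹ * g * z = g}) : (z.1 * c h)⁻¹ * g * (z.1 * c h) = h.1 := by
    rw [← hc h]
    conv_rhs => rw [← z.2]
    group
  refine Nat.card_congr
    { toFun x := (r x, ⟨x.1 * (c (r x))⁻¹, ?_⟩)
      invFun y := ⟨y.2.1 * c y.1, by rw [hz]; exact y.1.1.2⟩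
      left_inv x := by simp
      right_inv y := ?_ }
  · have h1 : (c (r x))⁻¹ * g * c (r x) = x.1⁻¹ * g * x.1 := hc (r x)
    calc (x.1 * (c (r x))⁻¹)⁻¹ * g * (x.1 * (c (r x))⁻¹)
        = c (r x) * (x.1⁻¹ * g * x.1) * (c (r x))⁻¹ := by group
      _ = g := by rw [← h1]; group
  · have h2 : r ⟨y.2.1 * c y.1, by rw [hz]; exact y.1.1.2⟩ = y.1 :=
      Subtype.ext (Subtype.ext (hz _ _))
    refine Prod.ext h2 (Subtype.ext ?_)
    simp [h2]

end Subgroup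

lemma pointwiseConj_of_ncard_fixedBy_eq {G : Type*} [Group G] [Finite G] {H K : Subgroup G}
    (hcard : Nat.card H = Nat.card K)
    (h : ∀ g : G, g ^ Nat.card H = 1 →
      (MulAction.fixedBy (G ⧸ H) g).ncard = (MulAction.fixedBy (G ⧸ K) g).ncard) :
    PointwiseConj H K := by
  have hfiber (c : ConjClasses G) : Nonempty ({x : H // ConjClasses.mk (x : G) = c} ≃
      {x : K // ConjClasses.mk (x : G) = c}) := by
    obtain ⟨g, rfl⟩ := ConjClasses.mk_surjective c
    refine Finite.card_eq.mp ?_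
    by_cases hg : g ^ Nat.card H = 1
    · have := h g hg
      refine Nat.eq_of_mul_eq_mul_right (m := Nat.card {z : G // z⁻¹ * g * z = g}) ?_ ?_
      · have : Nonempty {z : G // z⁻¹ * g * z = g} := ⟨1, by simp⟩
        exact Nat.card_pos
      · rw [← Subgroup.card_conj_mem, ← Subgroup.card_conj_mem,
          ← Subgroup.ncard_fixedBy_quotient_mul_card, ← Subgroup.ncard_fixedBy_quotient_mul_card,
          this, hcard]
    · have hempty (L : Subgroup G) (hL : Nat.card H = Nat.card L) :
          IsEmpty {x : L // ConjClasses.mk (x : G) = ConjClasses.mk g} := by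
        refine ⟨fun x ↦ hg ?_⟩
        obtain ⟨y, hy⟩ := isConj_iff.mp (ConjClasses.mk_eq_mk_iff_isConj.mp x.2)
        rw [← hy, conj_pow, hL, ← Subgroup.coe_pow, pow_card_eq_one']
        simp
      have := hempty H rfl
      have := hempty K hcard
      rw [Nat.card_of_isEmpty, Nat.card_of_isEmpty]
  let e c := (hfiber c).some
  refine ⟨Equiv.ofFiberEquiv (f := fun x : H ↦ ConjClasses.mk (x : G))
    (g := fun x : K ↦ ConjClasses.mk (x : G)) e, fun x ↦ ?_⟩
  have h1 := Equiv.ofFiberEquiv_map (f := fun x : H ↦ ConjClasses.mk (x : G))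
    (g := fun x : K ↦ ConjClasses.mk (x : G)) e x
  obtain ⟨y, hy⟩ := isConj_iff.mp (ConjClasses.mk_eq_mk_iff_isConj.mp h1)
  exact ⟨y, by rw [← hy]; group⟩

/-- For subgroups `H, K` of a finite group `G` with orders prime to `p`, `H` and `K` are
pointwise conjugate in `G` iff the permutation representations of `G` over `F_p` on the coset
spaces `G/H` and `G/K` are isomorphic, i.e. `F_p[G/H] ≅ F_p[G/K]` as `F_p[G]`-modules. -/
theorem pointwiseConj_iff_fp_permutation_rep_iso
    (p : ℕ) (hp : p.Prime) (G : Type) [Group G] [Fintype G] (H K : Subgroup G)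
    (hH : Nat.Coprime (Nat.card H) p) (hK : Nat.Coprime (Nat.card K) p) :
    PointwiseConj H K ↔
      Nonempty (Rep.ofMulAction (ZMod p) G (G ⧸ H) ≅ Rep.ofMulAction (ZMod p) G (G ⧸ K)) := by
  have : Fact p.Prime := ⟨hp⟩
  constructor
  · intro h
    obtain ⟨e⟩ := h.nonempty_equiv_ofMulAction hH
    exact ⟨Rep.mkIso e⟩
  · rintro ⟨i⟩
    let e : (Representation.ofMulAction (ZMod p) G (G ⧸ H)).Equiv
      (Representation.ofMulAction (ZMod p) G (G ⧸ K)) := Representation.equivOfIso i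
    refine pointwiseConj_of_ncard_fixedBy_eq ?_ fun g hg ↦ e.ncard_fixedBy_eq hH hg
    have h1 := e.ncard_fixedBy_eq hH (one_pow _)
    simp only [MulAction.fixedBy_one_eq_univ, Set.ncard_univ] at h1
    refine Nat.eq_of_mul_eq_mul_left (Nat.card_pos (α := G ⧸ H)) ?_
    conv_rhs => rw [h1]
    rw [← Subgroup.card_eq_card_quotient_mul_card_subgroup,
      ← Subgroup.card_eq_card_quotient_mul_card_subgroup]
end

section
/- Let G be a finite group and let H, K be subgroups of G. Then H and K are pointwise conjugate in G if and only if the permutation representations of G over ℚ on the coset spaces G/H and G/K are isomorphic as representations of G (equivalently, ℚ[G/H] ≅ ℚ[G/K] as ℚ[G]-modules). -/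
open Module

section SemisimpleHom

variable {k A : Type*} [Field k] [Ring A] [Algebra k A]

/-- Conjugating by linear equivalences on both sides does not change the dimension of the space
of linear maps. -/
theorem finrank_linearMap_congr {M M' V V' : Type*}
    [AddCommGroup M] [Module A M] [AddCommGroup M'] [Module A M']
    [AddCommGroup V] [Module k V] [Module A V] [IsScalarTower k A V]
    [AddCommGroup V'] [Module k V'] [Module A V'] [IsScalarTower k A V']
    (e : M ≃ₗ[A] M') (f : V ≃ₗ[A] V') :
    finrank k (M →ₗ[A] V) = finrank k (M' →ₗ[A] V') :=
  LinearEquiv.finrank_eq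
    { LinearEquiv.arrowCongrAddEquiv e f with
      map_smul' := fun c φ => by
        ext x
        exact LinearMap.map_smul_of_tower f.toLinearMap c (φ (e.symm x)) }

theorem finite_linearMap_of_isScalarTower {M V : Type*}
    [AddCommGroup M] [Module k M] [Module A M] [IsScalarTower k A M] [Module.Finite k M]
    [AddCommGroup V] [Module k V] [Module A V] [IsScalarTower k A V] [Module.Finite k V] :
    Module.Finite k (M →ₗ[A] V) :=
  Module.Finite.of_injective (LinearMap.restrictScalarsₗ k A M V k)
    (LinearMap.restrictScalars_injective k)

theorem finrank_linearMap_prod {M V W : Type*}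
    [AddCommGroup M] [Module k M] [Module A M] [IsScalarTower k A M] [Module.Finite k M]
    [AddCommGroup V] [Module k V] [Module A V] [IsScalarTower k A V] [Module.Finite k V]
    [AddCommGroup W] [Module k W] [Module A W] [IsScalarTower k A W] [Module.Finite k W] :
    finrank k (M →ₗ[A] V × W) = finrank k (M →ₗ[A] V) + finrank k (M →ₗ[A] W) := by
  have := finite_linearMap_of_isScalarTower (k := k) (A := A) (M := M) (V := V)
  have := finite_linearMap_of_isScalarTower (k := k) (A := A) (M := M) (V := W)
  rw [← (LinearMap.prodEquiv k).finrank_eq, finrank_prod]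

/-- A finite-dimensional module over a semisimple algebra is determined up to isomorphism by
the dimensions of the spaces of homomorphisms into it. -/
theorem nonempty_linearEquiv_of_finrank_linearMap_eq.{u} [IsSemisimpleRing A] {V W : Type u}
    [AddCommGroup V] [Module k V] [Module A V] [IsScalarTower k A V] [Module.Finite k V]
    [AddCommGroup W] [Module k W] [Module A W] [IsScalarTower k A W] [Module.Finite k W]
    (h : ∀ (M : Type u) [AddCommGroup M] [Module k M] [Module A M] [IsScalarTower k A M]
      [Module.Finite k M], finrank k (M →ₗ[A] V) = finrank k (M →ₗ[A] W)) :
    Nonempty (V ≃ₗ[A] W) := by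
  induction hn : finrank k V using Nat.strong_induction_on generalizing V W with
  | _ n ih =>
  cases subsingleton_or_nontrivial V with
  | inl hV =>
    have := finite_linearMap_of_isScalarTower (k := k) (A := A) (M := W) (V := W)
    have hW : Subsingleton (W →ₗ[A] W) := by
      rw [← finrank_zero_iff (R := k), ← h W]
      exact finrank_zero_of_subsingleton
    have : Subsingleton W := ⟨fun x y => by
      simpa using DFunLike.congr_fun (Subsingleton.elim (LinearMap.id : W →ₗ[A] W) 0) x |>.trans
        (DFunLike.congr_fun (Subsingleton.elim (LinearMap.id : W →ₗ[A] W) 0) y).symm⟩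
    exact ⟨0⟩
  | inr hV =>
    obtain ⟨S, hS⟩ := IsSemisimpleModule.exists_simple_submodule A V
    have hSk : Module.Finite k S :=
      inferInstanceAs (Module.Finite k (S.restrictScalars k))
    have := finite_linearMap_of_isScalarTower (k := k) (A := A) (M := S) (V := V)
    have := finite_linearMap_of_isScalarTower (k := k) (A := A) (M := S) (V := W)
    have := IsSimpleModule.nontrivial A S
    obtain ⟨f, hf⟩ : ∃ f : S →ₗ[A] W, f ≠ 0 := by
      rw [← finrank_pos_iff_exists_ne_zero (R := k), ← h S, finrank_pos_iff_exists_ne_zero]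
      refine ⟨S.subtype, fun h0 => ?_⟩
      obtain ⟨x, hx⟩ := exists_ne (0 : S)
      exact hx (Subtype.ext (DFunLike.congr_fun h0 x))
    have hinj : Function.Injective f := (LinearMap.injective_or_eq_zero f).resolve_right hf
    obtain ⟨P, hP⟩ := exists_isCompl S
    obtain ⟨Q, hQ⟩ := exists_isCompl (LinearMap.range f)
    have hPk : Module.Finite k P := inferInstanceAs (Module.Finite k (P.restrictScalars k))
    have hQk : Module.Finite k Q := inferInstanceAs (Module.Finite k (Q.restrictScalars k))
    let eV : (S × P) ≃ₗ[A] V := Submodule.prodEquivOfIsCompl S P hP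
    let eW : (S × Q) ≃ₗ[A] W :=
      (LinearEquiv.prodCongr (LinearEquiv.ofInjective f hinj) (LinearEquiv.refl A Q)).trans
        (Submodule.prodEquivOfIsCompl _ Q hQ)
    have hdim : finrank k P < n := by
      have h1 := (eV.restrictScalars k).finrank_eq
      rw [finrank_prod, hn] at h1
      have : 0 < finrank k S := finrank_pos
      omega
    obtain ⟨e⟩ := ih _ hdim (V := P) (W := Q) (fun M _ _ _ _ _ => by
      have h1 := h M
      rw [← finrank_linearMap_congr (LinearEquiv.refl A M) eV,
        ← finrank_linearMap_congr (LinearEquiv.refl A M) eW,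
        finrank_linearMap_prod, finrank_linearMap_prod] at h1
      omega) rfl
    exact ⟨eV.symm.trans ((LinearEquiv.prodCongr (LinearEquiv.refl A S) e).trans eW)⟩

end SemisimpleHom

namespace Representation

open scoped MonoidAlgebra

section

variable {k G : Type*} [Field k] [Group G]

/-- The module attached to the representation attached to a `k[G]`-module is that module. -/
noncomputable def asModuleOfModuleEquiv (M : Type*) [AddCommGroup M] [Module k M]
    [Module k[G] M] [IsScalarTower k k[G] M] :
    (ofModule' (k := k) (G := G) M).asModule ≃ₗ[k[G]] M :=
  { (ofModule' (k := k) (G := G) M).asModuleEquiv.toAddEquiv with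
    map_smul' := fun r x => by
      have : asAlgebraHom (ofModule' (k := k) (G := G) M) = Algebra.lsmul k k M :=
        (MonoidAlgebra.lift k (M →ₗ[k] M) G).apply_symm_apply _
      change asAlgebraHom (ofModule' (k := k) (G := G) M) r _ = _
      rw [this]
      rfl }

end

/-- Over a field of characteristic zero, finite-dimensional representations of a finite group
with the same character are isomorphic. -/
theorem nonempty_equiv_of_character_eq.{u} {k G : Type*} [Field k] [CharZero k] [Group G] [Finite G]
    {V W : Type u} [AddCommGroup V] [Module k V] [FiniteDimensional k V]
    [AddCommGroup W] [Module k W] [FiniteDimensional k W]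
    {ρ : Representation k G V} {σ : Representation k G W} (h : ρ.character = σ.character) :
    Nonempty (ρ.Equiv σ) := by
  have := Fintype.ofFinite G
  have : NeZero (Nat.card G : k) := ⟨Nat.cast_ne_zero.mpr Nat.card_pos.ne'⟩
  let : Invertible (Nat.card G : k) := invertibleOfNonzero (NeZero.ne _)
  obtain ⟨e⟩ : Nonempty (ρ.asModule ≃ₗ[k[G]] σ.asModule) := by
    refine nonempty_linearEquiv_of_finrank_linearMap_eq (k := k) fun M _ _ _ _ _ => ?_
    let τ := ofModule' (k := k) (G := G) M
    rw [← finrank_linearMap_congr (asModuleOfModuleEquiv M) (LinearEquiv.refl _ ρ.asModule),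
      ← finrank_linearMap_congr (asModuleOfModuleEquiv M) (LinearEquiv.refl _ σ.asModule),
      ← (IntertwiningMap.equivLinearMapAsModule τ ρ).finrank_eq,
      ← (IntertwiningMap.equivLinearMapAsModule τ σ).finrank_eq,
      ← Nat.cast_inj (R := k), ← card_inv_mul_sum_char_mul_char_eq_finrank,
      ← card_inv_mul_sum_char_mul_char_eq_finrank, h]
  let e' : V ≃ₗ[k] W :=
    ρ.asModuleEquiv.symm.trans ((e.restrictScalars k).trans σ.asModuleEquiv)
  refine ⟨Equiv.mk e' fun g => ?_⟩
  ext v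
  have h1 := e.map_smul (MonoidAlgebra.of k G g) (ρ.asModuleEquiv.symm v)
  rw [← asModuleEquiv_symm_map_rho] at h1
  have h2 := congrArg σ.asModuleEquiv h1
  rw [asModuleEquiv_map_smul, asAlgebraHom_of] at h2
  exact h2

/-- The character of a permutation representation counts fixed points. -/
theorem character_ofMulAction {k G X : Type*} [Field k] [Group G] [MulAction G X] [Finite X]
    (g : G) : (ofMulAction k G X).character g = Nat.card (MulAction.fixedBy X g) := by
  classical
  have := Fintype.ofFinite X
  let b : Basis X k (MonoidAlgebra k X) := .ofRepr (MonoidAlgebra.coeffLinearEquiv k)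
  rw [character, LinearMap.trace_eq_matrix_trace k b, Matrix.trace, Nat.card_eq_fintype_card,
    Fintype.card_subtype, Finset.card_filter, Nat.cast_sum]
  refine Finset.sum_congr rfl fun x _ => ?_
  have hb : b x = MonoidAlgebra.single x 1 := by
    apply b.repr.injective
    rw [b.repr_self]
    rfl
  rw [Matrix.diag_apply, LinearMap.toMatrix_apply, hb, ofMulAction_single]
  change (Finsupp.single (g • x) (1 : k)) x = _
  rw [Finsupp.single_apply]
  simp [MulAction.mem_fixedBy]

end Representation

section Counting

variable {G : Type*} [Group G] (H : Subgroup G)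

theorem card_conj_mem_eq_card_mul_card_fixedBy (g : G) :
    Nat.card {x : G // x⁻¹ * g * x ∈ H} =
      Nat.card H * Nat.card (MulAction.fixedBy (G ⧸ H) g) := by
  rw [← Nat.card_prod,
    ← Nat.card_congr (QuotientGroup.preimageMkEquivSubgroupProdSet H (MulAction.fixedBy (G ⧸ H) g))]
  refine Nat.card_congr (Equiv.subtypeEquivRight fun x => ?_)
  rw [Set.mem_preimage, MulAction.mem_fixedBy, MulAction.Quotient.smul_coe, eq_comm,
    QuotientGroup.eq, smul_eq_mul, mul_assoc]

theorem card_conj_mem_eq_card_mul_card_centralizer (g : G) :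
    Nat.card {x : G // x⁻¹ * g * x ∈ H} =
      Nat.card {h : H // ConjClasses.mk (h : G) = ConjClasses.mk g} *
        Nat.card {x : G // x⁻¹ * g * x = g} := by
  let f : {x : G // x⁻¹ * g * x ∈ H} → {h : H // ConjClasses.mk (h : G) = ConjClasses.mk g} :=
    fun x => ⟨⟨x.1⁻¹ * g * x.1, x.2⟩, by
      rw [ConjClasses.mk_eq_mk_iff_isConj, isConj_iff]
      exact ⟨x.1, by group⟩⟩
  rw [← Nat.card_prod]
  refine Nat.card_congr ((Equiv.sigmaFiberEquiv f).symm.trans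
    ((Equiv.sigmaCongrRight fun h => ?_).trans (Equiv.sigmaEquivProd _ _)))
  have hh := h.2
  rw [ConjClasses.mk_eq_mk_iff_isConj, isConj_iff] at hh
  let c := hh.choose
  have hc : c * h.1 * c⁻¹ = g := hh.choose_spec
  have hc' : c⁻¹ * g * c = h.1 := by
    calc c⁻¹ * g * c = c⁻¹ * (c * h.1 * c⁻¹) * c := by rw [hc]
      _ = h.1 := by group
  exact
    { toFun := fun x => ⟨x.1.1 * c⁻¹, by
        have hx : x.1.1⁻¹ * g * x.1.1 = h.1 := congrArg (fun y => (y.1 : G)) x.2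
        calc (x.1.1 * c⁻¹)⁻¹ * g * (x.1.1 * c⁻¹) = c * (x.1.1⁻¹ * g * x.1.1) * c⁻¹ := by group
          _ = g := by rw [hx, hc]⟩
      invFun := fun y =>
        have hy : (y.1 * c)⁻¹ * g * (y.1 * c) = h.1 := by
          calc (y.1 * c)⁻¹ * g * (y.1 * c) = c⁻¹ * (y.1⁻¹ * g * y.1) * c := by group
            _ = h.1 := by rw [y.2, hc']
        ⟨⟨y.1 * c, hy ▸ h.1.2⟩, Subtype.ext (Subtype.ext hy)⟩
      left_inv := fun x => by ext; simp
      right_inv := fun y => by ext; simp }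

end Counting

/-- Pointwise conjugate subgroups are those meeting every conjugacy class in equally many
elements. -/
theorem pointwiseConj_iff_card_eq {G : Type*} [Group G] [Finite G] (H K : Subgroup G) :
    PointwiseConj H K ↔ ∀ g : G,
      Nat.card {h : H // ConjClasses.mk (h : G) = ConjClasses.mk g} =
        Nat.card {h : K // ConjClasses.mk (h : G) = ConjClasses.mk g} := by
  constructor
  · rintro ⟨α, hα⟩ g
    refine Nat.card_congr (α.subtypeEquiv fun h => ?_)
    obtain ⟨x, hx⟩ := hα h
    have : ConjClasses.mk (α h : G) = ConjClasses.mk (h : G) := by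
      rw [ConjClasses.mk_eq_mk_iff_isConj, isConj_iff]
      exact ⟨x, by rw [hx]; group⟩
    rw [this]
  · intro hcard
    have e : ∀ c : ConjClasses G,
        Nonempty ({h : H // ConjClasses.mk (h : G) = c} ≃ {h : K // ConjClasses.mk (h : G) = c}) := by
      intro c
      obtain ⟨g, rfl⟩ := ConjClasses.exists_rep c
      exact Finite.card_eq.mp (hcard g)
    refine ⟨Equiv.ofFiberEquiv fun c => (e c).some, fun h => ?_⟩
    have hmap := Equiv.ofFiberEquiv_map (fun c => (e c).some) h
    rw [ConjClasses.mk_eq_mk_iff_isConj, isConj_iff] at hmap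
    obtain ⟨x, hx⟩ := hmap
    exact ⟨x, by rw [← hx]; group⟩

/-- Subgroups of a finite group are pointwise conjugate iff every group element has equally many
fixed points on the two coset spaces. -/
theorem pointwiseConj_iff_card_fixedBy_eq {G : Type*} [Group G] [Finite G] (H K : Subgroup G) :
    PointwiseConj H K ↔ ∀ g : G, Nat.card (MulAction.fixedBy (G ⧸ H) g) =
      Nat.card (MulAction.fixedBy (G ⧸ K) g) := by
  have key (L : Subgroup G) (g : G) :=
    (card_conj_mem_eq_card_mul_card_fixedBy L g).symm.trans
      (card_conj_mem_eq_card_mul_card_centralizer L g)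
  have hH : 0 < Nat.card H := Nat.card_pos
  constructor
  · intro h g
    have hcard : Nat.card H = Nat.card K := Nat.card_congr h.choose
    have h1 := key K g
    rw [← (pointwiseConj_iff_card_eq H K).mp h g, ← key H g, ← hcard] at h1
    exact (Nat.eq_of_mul_eq_mul_left hH h1).symm
  · intro h
    have hcard : Nat.card H = Nat.card K := by
      have h1 := h 1
      simp only [MulAction.fixedBy_one_eq_univ, Nat.card_univ] at h1
      have h2 := H.card_eq_card_quotient_mul_card_subgroup
      rw [K.card_eq_card_quotient_mul_card_subgroup, ← h1] at h2
      exact (Nat.eq_of_mul_eq_mul_left Nat.card_pos h2).symm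
    rw [pointwiseConj_iff_card_eq]
    intro g
    have : Nonempty {x : G // x⁻¹ * g * x = g} := ⟨⟨1, by simp⟩⟩
    refine Nat.eq_of_mul_eq_mul_right (Nat.card_pos (α := {x : G // x⁻¹ * g * x = g})) ?_
    have hK := key K g
    rw [← hcard, ← h g, key H g] at hK
    exact hK

/-- For subgroups `H, K` of a finite group `G`, `H` and `K` are pointwise conjugate in `G`
iff the permutation representations of `G` over `ℚ` on the coset spaces `G/H` and `G/K` are
isomorphic, i.e. `ℚ[G/H] ≅ ℚ[G/K]` as `ℚ[G]`-modules. -/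
theorem pointwiseConj_iff_rat_permutation_rep_iso
    (G : Type) [Group G] [Fintype G] (H K : Subgroup G) :
    PointwiseConj H K ↔
      Nonempty (Rep.ofMulAction ℚ G (G ⧸ H) ≅ Rep.ofMulAction ℚ G (G ⧸ K)) := by
  have hfin (L : Subgroup G) : FiniteDimensional ℚ (MonoidAlgebra ℚ (G ⧸ L)) :=
    Module.Finite.equiv (MonoidAlgebra.coeffLinearEquiv ℚ).symm
  have := hfin H
  have := hfin K
  rw [pointwiseConj_iff_card_fixedBy_eq]
  constructor
  · intro h
    obtain ⟨e⟩ := Representation.nonempty_equiv_of_character_eq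
      (ρ := Representation.ofMulAction ℚ G (G ⧸ H)) (σ := Representation.ofMulAction ℚ G (G ⧸ K))
      (by ext g; rw [Representation.character_ofMulAction, Representation.character_ofMulAction, h g])
    exact ⟨Rep.mkIso e⟩
  · rintro ⟨i⟩ g
    have h := congrFun (Representation.char_iso (Representation.equivOfIso i)) g
    rw [Rep.of_ρ, Rep.of_ρ, Representation.character_ofMulAction,
      Representation.character_ofMulAction] at h
    exact_mod_cast h
end
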